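/- For every ε > 0, the probability that Q^n(2) contains a connected component with at least (1−ε)·2^n vertices tends to 1 as n → ∞; in particular (taking ε < 1/2) w.h.p. Q^n(2) contains a unique giant component spanning all but o(2^n) vertices. -/

import Mathlib

open scoped Classical
open Filter

noncomputable section

/-- The vertex set of the `n`-dimensional hypercube: `{0,1}^n`. -/
abbrev Vtx (n : ℕ) := Fin n → Bool

/-- The `n`-dimensional hypercube graph `Q^n`: two vertices are adjacent iff they
differ in exactly one coordinate. -/
def cubeGraph (n : ℕ) : SimpleGraph (Vtx n) :=
  SimpleGraph.fromRel (fun u v => hammingDist u v = 1)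

/-- Sample space for the `k`-out model on `Q^n`: each vertex `v` chooses a
`k`-element set of its neighbours (equivalently, `k` incident edges). -/
abbrev KOut (n k : ℕ) :=
  ∀ v : Vtx n, {s : Finset (Vtx n) // s.card = k ∧ ∀ u ∈ s, (cubeGraph n).Adj v u}

/-- The random subgraph `Q^n(k)` produced by an outcome of the `k`-out model:
`u` and `v` are adjacent iff one of them chose the edge between them. -/
def kOutGraph (n k : ℕ) (ω : KOut n k) : SimpleGraph (Vtx n) :=
  SimpleGraph.fromRel (fun u v => v ∈ (ω u).1)

/-- Uniform (counting) probability of an event on a finite sample space. -/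
def prob {Ω : Type*} [Finite Ω] (p : Ω → Prop) : ℝ :=
  (Nat.card {ω : Ω // p ω} : ℝ) / (Nat.card Ω : ℝ)

/-- Number of vertices in the connected component of `v` in `G`. -/
def compSize {V : Type*} (G : SimpleGraph V) (v : V) : ℕ :=
  Nat.card {w : V // G.Reachable v w}

/-- The vertex obtained from `v` by flipping coordinate `i`. -/
def flipAt {n : ℕ} (i : Fin n) (v : Vtx n) : Vtx n := Function.update v i (!v i)

lemma flipAt_flipAt {n : ℕ} (i : Fin n) (v : Vtx n) : flipAt i (flipAt i v) = v := by
  simp [flipAt]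

lemma flipAt_apply_self {n : ℕ} (i : Fin n) (v : Vtx n) : flipAt i v i = !v i := by
  simp [flipAt]

lemma flipAt_apply_of_ne {n : ℕ} {i j : Fin n} (h : j ≠ i) (v : Vtx n) : flipAt i v j = v j := by
  simp [flipAt, h]

lemma flipAt_ne_self {n : ℕ} (i : Fin n) (v : Vtx n) : flipAt i v ≠ v := by
  intro h
  have := congrFun h i
  simp [flipAt_apply_self] at this

lemma flipAt_left_injective {n : ℕ} (v : Vtx n) :
    Function.Injective (fun i : Fin n => flipAt i v) := by
  intro i j h
  by_contra hij
  have h1 := congrFun h i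
  simp only [flipAt_apply_self, flipAt_apply_of_ne hij] at h1
  simp at h1

lemma flipAt_injective {n : ℕ} (i : Fin n) : Function.Injective (flipAt i) :=
  Function.LeftInverse.injective (flipAt_flipAt i)

lemma hammingDist_flipAt {n : ℕ} (i : Fin n) (v : Vtx n) : hammingDist v (flipAt i v) = 1 := by
  unfold hammingDist
  rw [Finset.card_eq_one]
  refine ⟨i, ?_⟩
  ext j
  by_cases h : j = i
  · subst h; simp [flipAt_apply_self]
  · simp [flipAt_apply_of_ne h, h]

lemma cubeGraph_adj_iff {n : ℕ} (u v : Vtx n) :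
    (cubeGraph n).Adj u v ↔ ∃ i, v = flipAt i u := by
  constructor
  · intro h
    have h1 : hammingDist u v = 1 := by
      rcases (SimpleGraph.fromRel_adj _ _ _).1 h with ⟨-, h | h⟩
      · exact h
      · rwa [hammingDist_comm]
    unfold hammingDist at h1
    obtain ⟨i, hi⟩ := Finset.card_eq_one.1 h1
    refine ⟨i, funext fun j => ?_⟩
    have hj : u j ≠ v j ↔ j = i := by simpa using (Finset.ext_iff.1 hi) j
    by_cases h : j = i
    · subst h
      rw [flipAt_apply_self]
      have := hj.2 rfl
      revert this
      cases u j <;> cases v j <;> simp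
    · rw [flipAt_apply_of_ne h]
      by_contra h2
      exact h (hj.1 (Ne.symm h2))
  · rintro ⟨i, rfl⟩
    exact (SimpleGraph.fromRel_adj _ _ _).2
      ⟨(flipAt_ne_self i u).symm, Or.inl (hammingDist_flipAt i u)⟩

lemma mul_logb_add_mul_logb_add_le {a b : ℝ} (ha : 0 ≤ a) (hab : a ≤ b) :
    a * Real.logb 2 a + b * Real.logb 2 b + 2 * a ≤ (a + b) * Real.logb 2 (a + b) := by
  rcases ha.eq_or_lt with rfl | ha
  · simp
  have hb : 0 < b := ha.trans_le hab
  have h1 : 1 + Real.logb 2 a ≤ Real.logb 2 (a + b) := by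
    have h2 : (1 : ℝ) = Real.logb 2 2 := by simp
    rw [h2, ← Real.logb_mul (by norm_num) ha.ne']
    exact Real.logb_le_logb_of_le (by norm_num) (by positivity) (by linarith)
  have h2 : a / b + Real.logb 2 b ≤ Real.logb 2 (a + b) := by
    have h3 : a + b = (1 + a / b) * b := by field_simp; ring
    rw [h3, Real.logb_mul (by positivity) hb.ne']
    have h4 : (2 : ℝ) ≤ (1 + a / b) ^ (b / a) := by
      have h5 := one_add_mul_self_le_rpow_one_add (s := a / b) (p := b / a)
        (by have : 0 < a / b := by positivity
            linarith) ((one_le_div ha).2 hab)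
      have h6 : b / a * (a / b) = 1 := by field_simp
      linarith
    have h7 : (1 : ℝ) ≤ b / a * Real.logb 2 (1 + a / b) := by
      rw [← Real.logb_rpow_eq_mul_logb_of_pos (by positivity)]
      rw [Real.le_logb_iff_rpow_le (by norm_num) (by positivity)]
      simpa using h4
    have h8 : a / b ≤ a / b * (b / a * Real.logb 2 (1 + a / b)) :=
      le_mul_of_one_le_right (by positivity) h7
    have h9 : a / b * (b / a * Real.logb 2 (1 + a / b)) = Real.logb 2 (1 + a / b) := by
      field_simp
    linarith
  have h3 : b * (a / b + Real.logb 2 b) ≤ b * Real.logb 2 (a + b) :=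
    mul_le_mul_of_nonneg_left h2 hb.le
  have h4 : b * (a / b) = a := by field_simp
  have h5 : a * (1 + Real.logb 2 a) ≤ a * Real.logb 2 (a + b) :=
    mul_le_mul_of_nonneg_left h1 ha.le
  nlinarith

/-- The number of coordinates `i ∈ T` whose flip keeps `u` inside `S`. -/
def innerDeg {n : ℕ} (S : Finset (Vtx n)) (T : Finset (Fin n)) (u : Vtx n) : ℕ :=
  (T.filter fun i => flipAt i u ∈ S).card

lemma sum_innerDeg_singleton_le {n : ℕ} (S : Finset (Vtx n)) (i : Fin n) (β : Bool) :
    ∑ u ∈ S, innerDeg S {i} u ≤ 2 * (S.filter fun u => u i = β).card := by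
  have h1 : ∀ u, innerDeg S {i} u = if flipAt i u ∈ S then 1 else 0 := by
    intro u
    by_cases h : flipAt i u ∈ S <;> simp [innerDeg, Finset.filter_singleton, h]
  simp only [h1, ← Finset.card_filter]
  rw [← Finset.card_filter_add_card_filter_not (p := fun u : Vtx n => u i = β), two_mul]
  refine add_le_add (Finset.card_le_card ?_) ?_
  · exact Finset.filter_subset_filter _ (Finset.filter_subset _ _)
  · refine Finset.card_le_card_of_injOn (flipAt i) ?_ (flipAt_injective i).injOn
    intro u hu
    simp only [Finset.coe_filter, Finset.mem_filter, Set.mem_ofPred_eq] at hu ⊢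
    refine ⟨hu.1.2, ?_⟩
    rw [flipAt_apply_self]
    revert hu
    cases u i <;> cases β <;> simp

/-- The edge-isoperimetric inequality of the hypercube. -/
lemma sum_innerDeg_le {n : ℕ} (T : Finset (Fin n)) : ∀ S : Finset (Vtx n),
    ((∑ u ∈ S, innerDeg S T u : ℕ) : ℝ) ≤ S.card * Real.logb 2 S.card := by
  induction T using Finset.induction_on with
  | empty =>
    intro S
    simp only [innerDeg, Finset.filter_empty, Finset.card_empty, Finset.sum_const_zero,
      Nat.cast_zero]
    rcases S.eq_empty_or_nonempty with rfl | hS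
    · simp
    · exact mul_nonneg (by positivity) (Real.logb_nonneg (by norm_num)
        (by exact_mod_cast hS.card_pos))
  | insert i T hi ih =>
    intro S
    have key : ∀ β : Bool, ∑ u ∈ S.filter (fun u => u i = β), innerDeg S T u =
        ∑ u ∈ S.filter (fun u => u i = β), innerDeg (S.filter fun u => u i = β) T u := by
      intro β
      refine Finset.sum_congr rfl fun u hu => ?_
      unfold innerDeg
      congr 1
      refine Finset.filter_congr fun j hj => ?_
      have hji : i ≠ j := fun h => hi (h ▸ hj)
      simp [flipAt_apply_of_ne hji, (Finset.mem_filter.1 hu).2]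
    have hsplit : ∑ u ∈ S, innerDeg S (insert i T) u =
        ∑ u ∈ S, innerDeg S {i} u + ∑ u ∈ S, innerDeg S T u := by
      rw [← Finset.sum_add_distrib]
      refine Finset.sum_congr rfl fun u _ => ?_
      unfold innerDeg
      rw [Finset.insert_eq, Finset.filter_union, Finset.card_union_of_disjoint]
      exact Finset.disjoint_filter_filter (by simpa using hi)
    have hnot : S.filter (fun u => ¬ u i = true) = S.filter (fun u => u i = false) := by
      simp
    have hcard := Finset.card_filter_add_card_filter_not (s := S) (p := fun u : Vtx n => u i = true)
    have hsum := Finset.sum_filter_add_sum_filter_not S (fun u : Vtx n => u i = true)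
      (fun u => innerDeg S T u)
    rw [hnot] at hcard hsum
    rw [key, key] at hsum
    have h0 := ih (S.filter fun u => u i = false)
    have h1 := ih (S.filter fun u => u i = true)
    have b0 := sum_innerDeg_singleton_le S i false
    have b1 := sum_innerDeg_singleton_le S i true
    rw [hsplit, ← hsum, ← hcard]
    set a := (S.filter fun u => u i = true).card
    set b := (S.filter fun u => u i = false).card
    push_cast at h0 h1 ⊢
    have b0' : ((∑ u ∈ S, innerDeg S {i} u : ℕ) : ℝ) ≤ 2 * b := by exact_mod_cast b0
    have b1' : ((∑ u ∈ S, innerDeg S {i} u : ℕ) : ℝ) ≤ 2 * a := by exact_mod_cast b1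
    push_cast at b0' b1'
    rcases le_total a b with hab | hab
    · have := mul_logb_add_mul_logb_add_le (a := a) (b := b) (by positivity) (by exact_mod_cast hab)
      linarith
    · have := mul_logb_add_mul_logb_add_le (a := b) (b := a) (by positivity) (by exact_mod_cast hab)
      rw [add_comm (a : ℝ) b]
      linarith

/-- The Varshamov–Tenengolts colouring of the hypercube: within a ball of radius one all
vertices have different colours. -/
def vtColour {n : ℕ} (v : Vtx n) : ZMod (2 * n + 1) :=
  ∑ i : Fin n, if v i then ((i + 1 : ℕ) : ZMod (2 * n + 1)) else 0

lemma vtColour_flipAt {n : ℕ} (i : Fin n) (v : Vtx n) :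
    vtColour (flipAt i v) = vtColour v + ((if v i then -(i + 1 : ℤ) else (i + 1 : ℤ) : ℤ) :
      ZMod (2 * n + 1)) := by
  unfold vtColour
  rw [Fintype.sum_eq_add_sum_compl i, Fintype.sum_eq_add_sum_compl i (fun j => if v j then _ else _)]
  have h : ∀ j ∈ ({i}ᶜ : Finset (Fin n)),
      (if flipAt i v j then ((j + 1 : ℕ) : ZMod (2 * n + 1)) else 0) =
        if v j then ((j + 1 : ℕ) : ZMod (2 * n + 1)) else 0 := by
    intro j hj
    rw [flipAt_apply_of_ne (by simpa using hj)]
  rw [Finset.sum_congr rfl h, flipAt_apply_self]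
  cases v i <;> simp <;> ring

lemma vtColour_flipAt_ne {n : ℕ} (i : Fin n) (v : Vtx n) :
    vtColour (flipAt i v) ≠ vtColour v := by
  rw [vtColour_flipAt]
  intro h
  rw [add_eq_left, ZMod.intCast_zmod_eq_zero_iff_dvd] at h
  have hi := i.2
  obtain ⟨k, hk⟩ := h
  have : k = 0 := by
    by_contra hk0
    have h1 : |(if v i then -(i + 1 : ℤ) else (i + 1 : ℤ) : ℤ)| < (2 * n + 1 : ℕ) := by
      rw [abs_lt]
      push_cast
      split_ifs <;> constructor <;> omega
    have := Int.eq_zero_of_abs_lt_dvd ⟨k, hk⟩ h1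
    split_ifs at this <;> omega
  subst this
  split_ifs at hk <;> omega

lemma eq_of_vtColour_flipAt_eq {n : ℕ} {i j : Fin n} {v : Vtx n}
    (h : vtColour (flipAt i v) = vtColour (flipAt j v)) : i = j := by
  rw [vtColour_flipAt, vtColour_flipAt] at h
  have h1 := (ZMod.intCast_eq_intCast_iff_dvd_sub _ _ _).1 (add_left_cancel h)
  have hi := i.2
  have hj := j.2
  have h2 := Int.eq_zero_of_abs_lt_dvd h1 (by
    rw [abs_lt]
    push_cast
    by_cases hij : i = j
    · subst hij
      split_ifs <;> constructor <;> omega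
    · have : (i : ℕ) ≠ j := fun h => hij (Fin.ext h)
      split_ifs <;> constructor <;> omega)
  apply Fin.ext
  split_ifs at h2 <;> omega

/-- A vertex set in which no two vertices are at distance at most two. -/
def IsCode {n : ℕ} (R : Finset (Vtx n)) : Prop :=
  (∀ u ∈ R, ∀ i, flipAt i u ∉ R) ∧ ∀ w i j, flipAt i w ∈ R → flipAt j w ∈ R → i = j

/-- The colour classes of `vtColour`. -/
def vtClass {n : ℕ} (c : ZMod (2 * n + 1)) : Finset (Vtx n) :=
  Finset.univ.filter fun v => vtColour v = c

lemma isCode_vtClass {n : ℕ} (c : ZMod (2 * n + 1)) : IsCode (vtClass (n := n) c) := by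
  refine ⟨fun u hu i h => ?_, fun w i j hi hj => ?_⟩
  · simp only [vtClass, Finset.mem_filter, Finset.mem_univ, true_and] at hu h
    exact vtColour_flipAt_ne i u (h.trans hu.symm)
  · simp only [vtClass, Finset.mem_filter, Finset.mem_univ, true_and] at hi hj
    exact eq_of_vtColour_flipAt_eq (hi.trans hj.symm)

/-- `S` contains `v` and induces a connected subgraph of the hypercube. -/
def IsConnAt {n : ℕ} (v : Vtx n) (S : Finset (Vtx n)) : Prop :=
  v ∈ S ∧ ∀ X : Finset (Vtx n), v ∈ X →
    (∀ u ∈ X, u ∈ S → ∀ i, flipAt i u ∈ S → flipAt i u ∈ X) → S ⊆ X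

/-- The outer vertex boundary of `S` in the hypercube. -/
def outerBoundary {n : ℕ} (S : Finset (Vtx n)) : Finset (Vtx n) :=
  Finset.univ.filter fun u => u ∉ S ∧ ∃ w ∈ S, ∃ i, flipAt i w = u

lemma card_outerBoundary_le {n : ℕ} (S : Finset (Vtx n)) :
    (outerBoundary S).card ≤ n * S.card := by
  have h : outerBoundary S ⊆ (S ×ˢ (Finset.univ : Finset (Fin n))).image
      (fun q => flipAt q.2 q.1) := by
    intro u hu
    obtain ⟨-, w, hw, i, hi⟩ := by simpa [outerBoundary] using hu
    exact Finset.mem_image.2 ⟨(w, i), by simp [hw], hi⟩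
  calc (outerBoundary S).card ≤ _ := Finset.card_le_card h
    _ ≤ _ := Finset.card_image_le
    _ = n * S.card := by simp [mul_comm]

lemma IsConnAt.subset_of_disjoint {n : ℕ} {v : Vtx n} {S S' X : Finset (Vtx n)}
    (hv : v ∈ S) (h' : IsConnAt v S') (hX : Disjoint X (outerBoundary S)) (hX' : S' ⊆ X) :
    S' ⊆ S := by
  refine h'.2 S hv fun u hu hu' i hi => ?_
  by_contra hn
  refine (Finset.disjoint_left.1 hX) (hX' hi) ?_
  simp only [outerBoundary, Finset.mem_filter, Finset.mem_univ, true_and]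
  exact ⟨hn, u, hu, i, rfl⟩

/-- The possible clusters of `v` in site percolation have total probability at most one. -/
lemma sum_isConnAt_le_one {n : ℕ} (v : Vtx n) {p : ℝ} (hp0 : 0 ≤ p) (hp1 : p ≤ 1) :
    ∑ S ∈ Finset.univ.filter (IsConnAt v), p ^ (S.card - 1) * (1 - p) ^ (n * S.card) ≤ 1 := by
  set f : Vtx n → ℝ := fun u => if u = v then 1 else p with hf
  set g : Vtx n → ℝ := fun u => if u = v then 0 else 1 - p with hg
  have hq : 0 ≤ 1 - p := by linarith
  have hf0 : ∀ u, 0 ≤ f u := by intro u; simp only [hf]; split_ifs <;> linarith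
  have hg0 : ∀ u, 0 ≤ g u := by intro u; simp only [hg]; split_ifs <;> linarith
  have hfg : ∀ u, f u + g u = 1 := by intro u; simp only [hf, hg]; split_ifs <;> ring
  set w : Finset (Vtx n) → ℝ := fun X => (∏ u ∈ X, f u) * ∏ u ∈ Finset.univ \ X, g u with hw
  have hw0 : ∀ X, 0 ≤ w X := fun X =>
    mul_nonneg (Finset.prod_nonneg fun u _ => hf0 u) (Finset.prod_nonneg fun u _ => hg0 u)
  have hw1 : ∑ X, w X = 1 := by
    have := Finset.prod_add f g Finset.univ
    rw [Finset.powerset_univ] at this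
    rw [← this]
    exact Finset.prod_eq_one fun u _ => hfg u
  let ev : Finset (Vtx n) → Finset (Vtx n) → Prop :=
    fun S X => S ⊆ X ∧ Disjoint X (outerBoundary S)
  have hS : ∀ S ∈ Finset.univ.filter (IsConnAt v),
      p ^ (S.card - 1) * (1 - p) ^ (n * S.card) ≤ ∑ X, if ev S X then w X else 0 := by
    intro S hS
    have hvS : v ∈ S := (Finset.mem_filter.1 hS).2.1
    set f' : Vtx n → ℝ := fun u => if u ∈ outerBoundary S then 0 else f u with hf'
    set g' : Vtx n → ℝ := fun u => if u ∈ S then 0 else g u with hg'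
    have hdisj : Disjoint S (outerBoundary S) := by
      rw [Finset.disjoint_left]
      intro u hu hu'
      exact (Finset.mem_filter.1 hu').2.1 hu
    have h1 : ∏ u, (f' u + g' u) = p ^ (S.card - 1) * (1 - p) ^ (outerBoundary S).card := by
      have h2 : ∀ u, f' u + g' u =
          (if u ∈ S then f u else 1) * (if u ∈ outerBoundary S then 1 - p else 1) := by
        intro u
        by_cases hu : u ∈ S
        · have := Finset.disjoint_left.1 hdisj hu
          simp [hf', hg', hu, this]
        · by_cases hu' : u ∈ outerBoundary S
          · have huv : u ≠ v := fun h => hu (h ▸ hvS)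
            simp [hf', hg', hu, hu', hg, huv]
          · simp [hf', hg', hu, hu', hfg]
      simp only [h2, Finset.prod_mul_distrib]
      congr 1
      · rw [Finset.prod_ite_mem, Finset.univ_inter, ← Finset.mul_prod_erase _ _ hvS]
        rw [Finset.prod_congr rfl (g := fun _ => p)]
        · simp [hf, Finset.card_erase_of_mem hvS]
        · intro u hu
          simp [hf, (Finset.mem_erase.1 hu).1]
      · rw [Finset.prod_ite_mem, Finset.univ_inter, Finset.prod_const]
    calc p ^ (S.card - 1) * (1 - p) ^ (n * S.card)
        ≤ p ^ (S.card - 1) * (1 - p) ^ (outerBoundary S).card := by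
          refine mul_le_mul_of_nonneg_left ?_ (by positivity)
          exact pow_le_pow_of_le_one hq (by linarith) (card_outerBoundary_le S)
      _ = ∑ X, (∏ u ∈ X, f' u) * ∏ u ∈ Finset.univ \ X, g' u := by
          rw [← h1, Finset.prod_add, Finset.powerset_univ]
      _ ≤ _ := by
          refine Finset.sum_le_sum fun X _ => ?_
          split_ifs with hX
          · refine le_of_eq ?_
            simp only [hw]
            congr 1
            · refine Finset.prod_congr rfl fun u hu => ?_
              simp [hf', Finset.disjoint_left.1 hX.2 hu]
            · refine Finset.prod_congr rfl fun u hu => ?_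
              have : u ∉ S := fun h => (Finset.mem_sdiff.1 hu).2 (hX.1 h)
              simp [hg', this]
          · refine le_of_eq ?_
            rw [mul_eq_zero]
            rw [not_and_or] at hX
            rcases hX with hX | hX
            · right
              obtain ⟨u, hu, hu'⟩ := Finset.not_subset.1 hX
              exact Finset.prod_eq_zero (i := u) (by simp [hu']) (by simp [hg', hu])
            · left
              obtain ⟨u, hu, hu'⟩ := Finset.not_disjoint_iff.1 hX
              exact Finset.prod_eq_zero (i := u) hu (by simp [hf', hu'])
  refine (Finset.sum_le_sum hS).trans ?_
  rw [Finset.sum_comm, ← hw1]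
  refine Finset.sum_le_sum fun X _ => ?_
  rw [← Finset.sum_filter, Finset.sum_const, nsmul_eq_mul]
  refine mul_le_of_le_one_left (hw0 X) ?_
  have : ((Finset.univ.filter (IsConnAt v)).filter fun S => ev S X).card ≤ 1 := by
    rw [Finset.card_le_one]
    intro S hS S' hS'
    simp only [Finset.mem_filter, Finset.mem_univ, true_and] at hS hS'
    exact Finset.Subset.antisymm
      (IsConnAt.subset_of_disjoint hS'.1.1 hS.1 hS'.2.2 hS.2.1)
      (IsConnAt.subset_of_disjoint hS.1.1 hS'.1 hS.2.2 hS'.2.1)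
  exact_mod_cast this

/-- Ordered choices of two distinct directions at each vertex: the second direction is recorded by
its index among the directions other than the first one. -/
abbrev Dirs (m : ℕ) := Vtx (m + 1) → Fin (m + 1) × Fin m

/-- The second of the two directions recorded by `q`. -/
def secondDir {m : ℕ} (q : Fin (m + 1) × Fin m) : Fin (m + 1) := q.1.succAbove q.2

/-- The graph of all chosen edges, except the second choices of the vertices of `R`. -/
def stageGraph {m : ℕ} (R : Finset (Vtx (m + 1))) (ω : Dirs m) : SimpleGraph (Vtx (m + 1)) :=
  SimpleGraph.fromRel fun u v =>
    v = flipAt (ω u).1 u ∨ (u ∉ R ∧ v = flipAt (secondDir (ω u)) u)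

/-- The vertex set of the connected component of `v`. -/
def compFinset {V : Type*} [Fintype V] (G : SimpleGraph V) (v : V) : Finset V :=
  Finset.univ.filter fun w => G.Reachable v w

lemma mem_compFinset {V : Type*} [Fintype V] {G : SimpleGraph V} {v w : V} :
    w ∈ compFinset G v ↔ G.Reachable v w := by
  simp [compFinset]

lemma stageGraph_adj_first {m : ℕ} (R : Finset (Vtx (m + 1))) (ω : Dirs m) (u : Vtx (m + 1)) :
    (stageGraph R ω).Adj u (flipAt (ω u).1 u) :=
  (SimpleGraph.fromRel_adj _ _ _).2 ⟨(flipAt_ne_self _ _).symm, Or.inl (Or.inl rfl)⟩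

lemma stageGraph_adj_second {m : ℕ} {R : Finset (Vtx (m + 1))} (ω : Dirs m) {u : Vtx (m + 1)}
    (hu : u ∉ R) : (stageGraph R ω).Adj u (flipAt (secondDir (ω u)) u) :=
  (SimpleGraph.fromRel_adj _ _ _).2 ⟨(flipAt_ne_self _ _).symm, Or.inl (Or.inr ⟨hu, rfl⟩)⟩

lemma exists_flipAt_of_stageGraph_adj {m : ℕ} {R : Finset (Vtx (m + 1))} {ω : Dirs m}
    {u v : Vtx (m + 1)} (h : (stageGraph R ω).Adj u v) : ∃ i, v = flipAt i u := by
  rcases (SimpleGraph.fromRel_adj _ _ _).1 h with ⟨-, (h | h) | (h | h)⟩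
  · exact ⟨_, h⟩
  · exact ⟨_, h.2⟩
  · exact ⟨(ω v).1, by rw [h, flipAt_flipAt]⟩
  · exact ⟨secondDir (ω v), by rw [h.2, flipAt_flipAt]⟩

lemma isConnAt_compFinset {m : ℕ} (R : Finset (Vtx (m + 1))) (ω : Dirs m) (v : Vtx (m + 1)) :
    IsConnAt v (compFinset (stageGraph R ω) v) := by
  refine ⟨mem_compFinset.2 (SimpleGraph.Reachable.refl v), fun X hv hX w hw => ?_⟩
  rw [mem_compFinset] at hw
  have hw' := (SimpleGraph.reachable_iff_reflTransGen _ _).1 hw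
  clear hw
  induction hw' with
  | refl => exact hv
  | @tail b c hb hbc ih =>
    have hbr := (SimpleGraph.reachable_iff_reflTransGen _ _).2 hb
    obtain ⟨i, rfl⟩ := exists_flipAt_of_stageGraph_adj hbc
    exact hX b ih (mem_compFinset.2 hbr) i (mem_compFinset.2 (hbr.trans hbc.reachable))

lemma mem_compFinset_of_adj {V : Type*} [Fintype V] {G : SimpleGraph V} {v u w : V}
    (hu : u ∈ compFinset G v) (h : G.Adj u w) : w ∈ compFinset G v :=
  mem_compFinset.2 ((mem_compFinset.1 hu).trans h.reachable)

lemma secondDir_ne {m : ℕ} (q : Fin (m + 1) × Fin m) : secondDir q ≠ q.1 :=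
  Fin.succAbove_ne _ _

lemma two_mul_card_inter_le {m : ℕ} {R S : Finset (Vtx (m + 1))} (hR : IsCode R) (ω : Dirs m)
    (hS : ∀ u ∈ S, flipAt (ω u).1 u ∈ S) : 2 * (S.filter (· ∈ R)).card ≤ S.card := by
  rw [← Finset.card_filter_add_card_filter_not (s := S) (p := (· ∈ R)), two_mul]
  refine Nat.add_le_add_left ?_ _
  refine Finset.card_le_card_of_injOn (fun u => flipAt (ω u).1 u) ?_ ?_
  · intro u hu
    simp only [Finset.coe_filter, Set.mem_ofPred_eq] at hu ⊢
    exact ⟨hS u hu.1, hR.1 u hu.2 _⟩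
  · intro u hu u' hu' h
    simp only [Finset.coe_filter, Set.mem_ofPred_eq] at hu hu' h
    have h1 : flipAt (ω u).1 (flipAt (ω u).1 u) ∈ R := by rw [flipAt_flipAt]; exact hu.2
    have h2 : flipAt (ω u').1 (flipAt (ω u).1 u) ∈ R := by rw [h, flipAt_flipAt]; exact hu'.2
    have h3 := hR.2 _ _ _ h1 h2
    rw [h3] at h
    exact flipAt_injective _ h

lemma three_le_card {m : ℕ} {R S : Finset (Vtx (m + 1))} (hR : IsCode R) (ω : Dirs m)
    (hne : S.Nonempty) (hS : ∀ u ∈ S, flipAt (ω u).1 u ∈ S)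
    (hS' : ∀ u ∈ S, u ∉ R → flipAt (secondDir (ω u)) u ∈ S) : 3 ≤ S.card := by
  obtain ⟨u, hu, huR⟩ : ∃ u ∈ S, u ∉ R := by
    obtain ⟨v, hv⟩ := hne
    by_cases h : v ∈ R
    · exact ⟨_, hS v hv, hR.1 v h _⟩
    · exact ⟨v, hv, h⟩
  have h2 := hS u hu
  have h3 := hS' u hu huR
  have h4 : Finset.card {u, flipAt (ω u).1 u, flipAt (secondDir (ω u)) u} = 3 := by
    refine Finset.card_eq_three.2 ⟨_, _, _, (flipAt_ne_self _ _).symm, (flipAt_ne_self _ _).symm,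
      fun h => secondDir_ne (ω u) (flipAt_left_injective u h).symm, rfl⟩
  rw [← h4]
  refine Finset.card_le_card ?_
  intro w hw
  simp only [Finset.mem_insert, Finset.mem_singleton] at hw
  rcases hw with rfl | rfl | rfl <;> assumption

/-- The choices at `u` compatible with `S` being closed in the first stage. -/
def innerChoices {m : ℕ} (R S : Finset (Vtx (m + 1))) (u : Vtx (m + 1)) :
    Finset (Fin (m + 1) × Fin m) :=
  Finset.univ.filter fun q => flipAt q.1 u ∈ S ∧ (u ∉ R → flipAt (secondDir q) u ∈ S)

lemma card_innerChoices_le_of_mem {m : ℕ} {R S : Finset (Vtx (m + 1))} {u : Vtx (m + 1)} :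
    (innerChoices R S u).card ≤ innerDeg S Finset.univ u * m := by
  have : innerChoices R S u ⊆
      (Finset.univ.filter fun i => flipAt i u ∈ S) ×ˢ (Finset.univ : Finset (Fin m)) := by
    intro q hq
    simp only [innerChoices, Finset.mem_filter, Finset.mem_univ, true_and] at hq
    simp [hq.1]
  refine (Finset.card_le_card this).trans ?_
  simp [innerDeg]

lemma card_innerChoices_le_of_notMem {m : ℕ} {R S : Finset (Vtx (m + 1))} {u : Vtx (m + 1)}
    (hu : u ∉ R) : (innerChoices R S u).card ≤
      innerDeg S Finset.univ u * innerDeg S Finset.univ u - innerDeg S Finset.univ u := by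
  have h := Finset.offDiag_card (s := Finset.univ.filter fun i : Fin (m + 1) => flipAt i u ∈ S)
  unfold innerDeg
  rw [← h]
  refine Finset.card_le_card_of_injOn (fun q => (q.1, secondDir q)) ?_ ?_
  · intro q hq
    simp only [innerChoices, Finset.coe_filter, Finset.mem_univ, true_and,
      Set.mem_ofPred_eq] at hq
    simp [hq.1, hq.2 hu, (secondDir_ne q).symm]
  · rintro ⟨i, j⟩ - ⟨i', j'⟩ - h
    simp only [secondDir, Prod.mk.injEq] at h
    obtain ⟨rfl, h⟩ := h
    rw [Fin.succAbove_right_injective h]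

lemma card_filter_forall_mem {V C : Type*} [Fintype V] [Fintype C] [Nonempty C]
    (S : Finset V) (T : V → Finset C) :
    ((Finset.univ.filter fun ω : V → C => ∀ u ∈ S, ω u ∈ T u).card : ℝ) =
      (∏ u ∈ S, ((T u).card : ℝ) / Fintype.card C) * Fintype.card (V → C) := by
  have h1 : (Finset.univ.filter fun ω : V → C => ∀ u ∈ S, ω u ∈ T u) =
      Fintype.piFinset fun u => if u ∈ S then T u else Finset.univ := by
    ext ω
    simp only [Finset.mem_filter, Finset.mem_univ, true_and, Fintype.mem_piFinset]
    refine forall_congr' fun u => ?_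
    by_cases h : u ∈ S <;> simp [h]
  have hC : (Fintype.card C : ℝ) ≠ 0 := by exact_mod_cast Fintype.card_ne_zero
  rw [h1, Fintype.card_piFinset, Fintype.card_fun, ← Finset.card_univ (α := V)]
  push_cast
  rw [← Finset.prod_const, ← Finset.univ_inter S, ← Finset.prod_ite_mem,
    ← Finset.prod_mul_distrib]
  refine Finset.prod_congr rfl fun u _ => ?_
  by_cases h : u ∈ S
  · simp [h, hC]
  · simp [h]

lemma card_innerChoices_div_le {m : ℕ} (hm : 1 ≤ m) {R S : Finset (Vtx (m + 1))}
    {u : Vtx (m + 1)} {l : ℝ} (hl : 1 ≤ l) :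
    ((innerChoices R S u).card : ℝ) / Fintype.card (Fin (m + 1) × Fin m) ≤
      l ^ 2 * Real.exp (2 * innerDeg S Finset.univ u / l) *
        (if u ∈ R then ((m : ℝ) + 1)⁻¹ else (((m : ℝ) + 1) ^ 2)⁻¹) := by
  set d := innerDeg S Finset.univ u with hd
  have hdm : d ≤ m + 1 := by
    have := Finset.card_filter_le (Finset.univ : Finset (Fin (m + 1))) fun i => flipAt i u ∈ S
    simpa [hd, innerDeg] using this
  have hdm' : (d : ℝ) ≤ m + 1 := by exact_mod_cast hdm
  have hm' : (1 : ℝ) ≤ m := by exact_mod_cast hm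
  have hl0 : 0 < l := by linarith
  have hexp : Real.exp (2 * d / l) = Real.exp (d / l) ^ 2 := by
    rw [← Real.exp_nat_mul]; congr 1; push_cast; ring
  have h1 : (d : ℝ) ≤ l * Real.exp (d / l) := by
    have := Real.add_one_le_exp ((d : ℝ) / l)
    calc (d : ℝ) = l * (d / l) := by field_simp
      _ ≤ _ := by gcongr; linarith
  have h2 : (1 : ℝ) ≤ l * Real.exp (d / l) :=
    one_le_mul_of_one_le_of_one_le hl (Real.one_le_exp (by positivity))
  rw [hexp, ← mul_pow]
  set y := l * Real.exp (d / l)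
  simp only [Fintype.card_prod, Fintype.card_fin]
  push_cast
  split_ifs with hu
  · have h3 : ((innerChoices R S u).card : ℝ) ≤ d * m := by
      exact_mod_cast card_innerChoices_le_of_mem
    calc ((innerChoices R S u).card : ℝ) / ((m + 1) * m) ≤ d * m / ((m + 1) * m) := by gcongr
      _ = d * ((m : ℝ) + 1)⁻¹ := by field_simp
      _ ≤ _ := by gcongr; nlinarith
  · have h3 : ((innerChoices R S u).card : ℝ) ≤ d * d - d := by
      have h4 := card_innerChoices_le_of_notMem (S := S) hu
      rw [← hd] at h4
      have h5 : (innerChoices R S u).card + d ≤ d * d := by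
        have : d ≤ d * d := Nat.le_mul_self d
        omega
      have : ((innerChoices R S u).card : ℝ) + d ≤ d * d := by exact_mod_cast h5
      linarith
    rw [← div_eq_mul_inv, div_le_div_iff₀ (by positivity) (by positivity)]
    have hd0 : (0 : ℝ) ≤ d := by positivity
    have h6 : (d : ℝ) * d ≤ y ^ 2 := by nlinarith
    calc ((innerChoices R S u).card : ℝ) * ((m : ℝ) + 1) ^ 2
        ≤ ((d : ℝ) * d - d) * ((m : ℝ) + 1) ^ 2 := by gcongr
      _ ≤ ((d : ℝ) * d) * (((m : ℝ) + 1) * m) := by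
          nlinarith [mul_nonneg (mul_nonneg hd0 (sub_nonneg.2 hdm')) (by positivity :
            (0 : ℝ) ≤ (m : ℝ) + 1)]
      _ ≤ _ := by gcongr

lemma exp_neg_one_le_pow (k : ℕ) :
    Real.exp (-1) ≤ (1 - ((k : ℝ) + 1)⁻¹) ^ k := by
  rcases Nat.eq_zero_or_pos k with rfl | hk
  · simp
  have hk' : (0 : ℝ) < k := by exact_mod_cast hk
  have h1 : (1 - ((k : ℝ) + 1)⁻¹) = (1 + (k : ℝ)⁻¹)⁻¹ := by field_simp; ring
  rw [h1, inv_pow, Real.exp_neg]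
  gcongr
  calc (1 + (k : ℝ)⁻¹) ^ k ≤ (Real.exp (k : ℝ)⁻¹) ^ k := by
        gcongr
        linarith [Real.add_one_le_exp (k : ℝ)⁻¹]
    _ = Real.exp 1 := by
        rw [← Real.exp_nat_mul]; congr 1; field_simp

lemma clusterWeight_ge {n s : ℕ} (hn : 1 ≤ n) (hs : 1 ≤ s) :
    (n : ℝ) * ((n : ℝ) ^ s)⁻¹ * ((2 * Real.exp 1) ^ s)⁻¹ ≤
      (((n : ℝ) + 1)⁻¹) ^ (s - 1) * (1 - ((n : ℝ) + 1)⁻¹) ^ (n * s) := by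
  have hn' : (1 : ℝ) ≤ n := by exact_mod_cast hn
  have h1 : ((Real.exp 1) ^ s)⁻¹ ≤ (1 - ((n : ℝ) + 1)⁻¹) ^ (n * s) := by
    rw [pow_mul, ← inv_pow, ← Real.exp_neg]
    gcongr
    exact exp_neg_one_le_pow n
  have h2 : (n : ℝ) * ((n : ℝ) ^ s)⁻¹ * ((2 : ℝ) ^ s)⁻¹ ≤ (((n : ℝ) + 1)⁻¹) ^ (s - 1) := by
    obtain ⟨t, rfl⟩ := Nat.exists_eq_add_of_le' hs
    simp only [Nat.add_sub_cancel]
    calc (n : ℝ) * ((n : ℝ) ^ (t + 1))⁻¹ * ((2 : ℝ) ^ (t + 1))⁻¹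
        = ((2 * (n : ℝ))⁻¹) ^ t * 2⁻¹ := by
          rw [inv_pow, mul_pow, pow_succ, pow_succ]; field_simp
      _ ≤ ((2 * (n : ℝ))⁻¹) ^ t * 1 := by gcongr; norm_num
      _ ≤ (((n : ℝ) + 1)⁻¹) ^ t := by
          rw [mul_one]; gcongr; linarith
  calc (n : ℝ) * ((n : ℝ) ^ s)⁻¹ * ((2 * Real.exp 1) ^ s)⁻¹
      = ((n : ℝ) * ((n : ℝ) ^ s)⁻¹ * ((2 : ℝ) ^ s)⁻¹) * ((Real.exp 1) ^ s)⁻¹ := by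
        rw [mul_pow, mul_inv]; ring
    _ ≤ _ := by gcongr

lemma prod_innerChoices_le {m : ℕ} (hm : 1 ≤ m) {R S : Finset (Vtx (m + 1))} {l : ℝ}
    (hl : 1 ≤ l) (hS : Real.logb 2 S.card ≤ l) :
    ∏ u ∈ S, ((innerChoices R S u).card : ℝ) / Fintype.card (Fin (m + 1) × Fin m) ≤
      (l * Real.exp 1) ^ (2 * S.card) *
        (((m : ℝ) + 1)⁻¹) ^ (2 * S.card - (S.filter (· ∈ R)).card) := by
  have hl0 : 0 < l := by linarith
  refine (Finset.prod_le_prod (fun u _ => by positivity)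
    fun u _ => card_innerChoices_div_le hm hl).trans ?_
  rw [Finset.prod_mul_distrib, Finset.prod_mul_distrib, Finset.prod_const, ← Real.exp_sum,
    Finset.prod_ite, Finset.prod_const, Finset.prod_const]
  have h1 : ∑ u ∈ S, 2 * (innerDeg S Finset.univ u : ℝ) / l ≤ 2 * S.card := by
    rw [← Finset.sum_div, ← Finset.mul_sum, div_le_iff₀ hl0]
    have := sum_innerDeg_le Finset.univ S
    push_cast at this
    have h2 : (S.card : ℝ) * Real.logb 2 S.card ≤ S.card * l := by gcongr
    linarith
  have hc := Finset.card_filter_add_card_filter_not (s := S) (p := (· ∈ R))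
  have h3 : 2 * S.card - (S.filter (· ∈ R)).card =
      (S.filter (· ∈ R)).card + 2 * (S.filter (· ∉ R)).card := by omega
  rw [h3, mul_pow, pow_add, pow_mul l, pow_mul (((m : ℝ) + 1)⁻¹) 2, inv_pow _ 2]
  gcongr
  rw [← Real.exp_nat_mul]
  gcongr
  push_cast
  linarith

lemma prod_innerChoices_le_clusterWeight {m : ℕ} (hm : 1 ≤ m) {R S : Finset (Vtx (m + 1))}
    {l : ℝ} (hl : 1 ≤ l) (hS : Real.logb 2 S.card ≤ l) (h3 : 3 ≤ S.card)
    (hR : 2 * (S.filter (· ∈ R)).card ≤ S.card)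
    (hx : 2 * Real.exp 1 ^ 3 * l ^ 2 / √((m : ℝ) + 1) ≤ 1) :
    ∏ u ∈ S, ((innerChoices R S u).card : ℝ) / Fintype.card (Fin (m + 1) × Fin m) ≤
      (2 * Real.exp 1 ^ 3 * l ^ 2 / √((m : ℝ) + 1)) ^ 3 / ((m : ℝ) + 1) *
      ((((m : ℝ) + 1) + 1)⁻¹ ^ (S.card - 1) *
        (1 - (((m : ℝ) + 1) + 1)⁻¹) ^ ((m + 1) * S.card)) := by
  set x := 2 * Real.exp 1 ^ 3 * l ^ 2 / √((m : ℝ) + 1) with hxd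
  set s := S.card
  set b := (S.filter (· ∈ R)).card
  have hl0 : 0 < l := by linarith
  have hN : (1 : ℝ) ≤ (m : ℝ) + 1 := by
    have : (0 : ℝ) ≤ m := by positivity
    linarith
  have hN0 : (0 : ℝ) < (m : ℝ) + 1 := by linarith
  have hr0 : 0 < √((m : ℝ) + 1) := Real.sqrt_pos.2 hN0
  have hx0 : 0 ≤ x := by positivity
  have hW := clusterWeight_ge (n := m + 1) (s := s) (by omega) (by omega)
  push_cast at hW
  have hsq : (((m : ℝ) + 1)⁻¹) ^ (s - b) ≤ ((√((m : ℝ) + 1))⁻¹) ^ s := by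
    have h1 : ((m : ℝ) + 1)⁻¹ = ((√((m : ℝ) + 1))⁻¹) ^ 2 := by
      rw [inv_pow, Real.sq_sqrt hN0.le]
    rw [h1, ← pow_mul]
    refine pow_le_pow_of_le_one (by positivity) ?_ (by omega)
    exact inv_le_one_of_one_le₀ (Real.one_le_sqrt.2 hN)
  calc _ ≤ (l * Real.exp 1) ^ (2 * s) * (((m : ℝ) + 1)⁻¹) ^ (2 * s - b) :=
        prod_innerChoices_le hm hl hS
    _ = (l * Real.exp 1) ^ (2 * s) * (((m : ℝ) + 1)⁻¹) ^ (s - b) * (((m : ℝ) + 1)⁻¹) ^ s := by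
        rw [mul_assoc, ← pow_add]; congr 2; omega
    _ ≤ (l * Real.exp 1) ^ (2 * s) * ((√((m : ℝ) + 1))⁻¹) ^ s * (((m : ℝ) + 1)⁻¹) ^ s := by
        gcongr
    _ = x ^ s * (((m : ℝ) + 1)⁻¹ * (((m : ℝ) + 1) * (((m : ℝ) + 1) ^ s)⁻¹ *
          ((2 * Real.exp 1) ^ s)⁻¹)) := by
        rw [hxd, pow_mul, div_eq_mul_inv]
        simp only [mul_pow, ← pow_mul, inv_pow]
        rw [mul_comm 3 s, mul_comm 2 s, pow_mul (Real.exp 1) s 3, pow_mul (Real.exp 1) s 2]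
        field_simp
    _ ≤ x ^ 3 * (((m : ℝ) + 1)⁻¹ * _) := by
        refine mul_le_mul (pow_le_pow_of_le_one hx0 hx h3)
          (mul_le_mul_of_nonneg_left hW (by positivity)) (by positivity) (by positivity)
    _ = _ := by
        rw [div_eq_mul_inv, mul_assoc]

/-- The vertices lying in first-stage components with fewer than `K` vertices. -/
def smallSet {m : ℕ} (R : Finset (Vtx (m + 1))) (K : ℕ) (ω : Dirs m) : Finset (Vtx (m + 1)) :=
  Finset.univ.filter fun v => (compFinset (stageGraph R ω) v).card < K

/-- Every fixed vertex is unlikely to lie in a small first-stage component. -/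
lemma card_mem_smallSet_le {m K : ℕ} (hm : 1 ≤ m) {R : Finset (Vtx (m + 1))} (hR : IsCode R)
    {l : ℝ} (hl : 1 ≤ l) (hK : Real.logb 2 K ≤ l)
    (hx : 2 * Real.exp 1 ^ 3 * l ^ 2 / √((m : ℝ) + 1) ≤ 1) (v : Vtx (m + 1)) :
    ((Finset.univ.filter fun ω : Dirs m => v ∈ smallSet R K ω).card : ℝ) ≤
      (2 * Real.exp 1 ^ 3 * l ^ 2 / √((m : ℝ) + 1)) ^ 3 / ((m : ℝ) + 1) *
        Fintype.card (Dirs m) := by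
  have : Nonempty (Fin m) := ⟨⟨0, hm⟩⟩
  set x := 2 * Real.exp 1 ^ 3 * l ^ 2 / √((m : ℝ) + 1) with hxd
  have hx0 : 0 ≤ x := by positivity
  set F := (Finset.univ.filter (IsConnAt v)).filter fun S =>
    S.card < K ∧ 3 ≤ S.card ∧ 2 * (S.filter (· ∈ R)).card ≤ S.card with hF
  have hsub : (Finset.univ.filter fun ω : Dirs m => v ∈ smallSet R K ω) ⊆
      F.biUnion fun S => Finset.univ.filter fun ω => ∀ u ∈ S, ω u ∈ innerChoices R S u := by
    intro ω hω
    simp only [smallSet, Finset.mem_filter, Finset.mem_univ, true_and] at hω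
    set S := compFinset (stageGraph R ω) v with hSd
    have h1 : ∀ u ∈ S, flipAt (ω u).1 u ∈ S := fun u hu =>
      mem_compFinset_of_adj hu (stageGraph_adj_first R ω u)
    have h2 : ∀ u ∈ S, u ∉ R → flipAt (secondDir (ω u)) u ∈ S := fun u hu huR =>
      mem_compFinset_of_adj hu (stageGraph_adj_second ω huR)
    have hc := isConnAt_compFinset R ω v
    refine Finset.mem_biUnion.2 ⟨S, ?_, ?_⟩
    · simp only [hF, Finset.mem_filter, Finset.mem_univ, true_and]
      exact ⟨hc, hω, three_le_card hR ω ⟨v, hc.1⟩ h1 h2, two_mul_card_inter_le hR ω h1⟩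
    · simp only [innerChoices, Finset.mem_filter, Finset.mem_univ, true_and]
      exact fun u hu => ⟨h1 u hu, h2 u hu⟩
  have hp1 : (((m : ℝ) + 1) + 1)⁻¹ ≤ 1 := inv_le_one_of_one_le₀ (by
    have : (0 : ℝ) ≤ m := by positivity
    linarith)
  have hp0 : (0 : ℝ) ≤ (((m : ℝ) + 1) + 1)⁻¹ := by positivity
  calc _ ≤ ((F.biUnion fun S => Finset.univ.filter fun ω : Dirs m =>
          ∀ u ∈ S, ω u ∈ innerChoices R S u).card : ℝ) := by
        exact_mod_cast Finset.card_le_card hsub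
    _ ≤ ∑ S ∈ F, ((Finset.univ.filter fun ω : Dirs m =>
          ∀ u ∈ S, ω u ∈ innerChoices R S u).card : ℝ) := by
        exact_mod_cast Finset.card_biUnion_le
    _ ≤ ∑ S ∈ F, (x ^ 3 / ((m : ℝ) + 1) * ((((m : ℝ) + 1) + 1)⁻¹ ^ (S.card - 1) *
        (1 - (((m : ℝ) + 1) + 1)⁻¹) ^ ((m + 1) * S.card))) * Fintype.card (Dirs m) := by
        refine Finset.sum_le_sum fun S hS => ?_
        simp only [hF, Finset.mem_filter, Finset.mem_univ, true_and] at hS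
        obtain ⟨-, hSK, hS3, hSR⟩ := hS
        have hcard : ((Finset.univ.filter fun ω : Dirs m =>
            ∀ u ∈ S, ω u ∈ innerChoices R S u).card : ℝ) =
            (∏ u ∈ S, ((innerChoices R S u).card : ℝ) / Fintype.card (Fin (m + 1) × Fin m)) *
              Fintype.card (Dirs m) := by
          convert card_filter_forall_mem S (innerChoices R S)
        rw [hcard]
        gcongr
        refine prod_innerChoices_le_clusterWeight hm hl (le_trans ?_ hK) hS3 hSR hx
        refine Real.logb_le_logb_of_le (by norm_num) (by positivity) ?_
        exact_mod_cast hSK.le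
    _ = (x ^ 3 / ((m : ℝ) + 1) * ∑ S ∈ F, ((((m : ℝ) + 1) + 1)⁻¹ ^ (S.card - 1) *
        (1 - (((m : ℝ) + 1) + 1)⁻¹) ^ ((m + 1) * S.card))) * Fintype.card (Dirs m) := by
        rw [← Finset.sum_mul, ← Finset.mul_sum]
    _ ≤ (x ^ 3 / ((m : ℝ) + 1) * 1) * Fintype.card (Dirs m) := by
        gcongr
        refine le_trans ?_ (sum_isConnAt_le_one v hp0 hp1)
        refine Finset.sum_le_sum_of_subset_of_nonneg (Finset.filter_subset _ _) fun S _ _ => ?_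
        have : 0 ≤ 1 - (((m : ℝ) + 1) + 1)⁻¹ := by linarith
        positivity
    _ = _ := by rw [mul_one]

lemma mem_of_reachable {V : Type*} {G : SimpleGraph V} {W : Finset V}
    (hW : ∀ u w, G.Adj u w → (u ∈ W ↔ w ∈ W)) {v w : V} (h : G.Reachable v w) :
    v ∈ W ↔ w ∈ W := by
  have h' := (SimpleGraph.reachable_iff_reflTransGen _ _).1 h
  induction h' with
  | refl => rfl
  | @tail b c hb hbc ih =>
    exact (ih ((SimpleGraph.reachable_iff_reflTransGen _ _).2 hb)).trans (hW b c hbc)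

lemma compFinset_eq_of_reachable {V : Type*} [Fintype V] {G : SimpleGraph V} {v w : V}
    (h : G.Reachable v w) : compFinset G v = compFinset G w := by
  ext x
  rw [mem_compFinset, mem_compFinset]
  exact ⟨fun h' => h.symm.trans h', fun h' => h.trans h'⟩

/-- There are few unions of components all of which have at least `K` vertices. -/
lemma card_unions_of_large_comps_le {V : Type*} [Fintype V] (G : SimpleGraph V) {K : ℕ}
    (hK : 0 < K) :
    (Finset.univ.filter fun W : Finset V => (∀ u w, G.Adj u w → (u ∈ W ↔ w ∈ W)) ∧
      ∀ v ∈ W, K ≤ (compFinset G v).card).card ≤ 2 ^ (Fintype.card V / K) := by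
  set C := (Finset.univ.filter fun v => K ≤ (compFinset G v).card).image (compFinset G) with hC
  have hCcard : C.card ≤ Fintype.card V / K := by
    rw [Nat.le_div_iff_mul_le hK]
    have hdisj : ∀ S ∈ C, ∀ S' ∈ C, S ≠ S' → Disjoint S S' := by
      intro S hS S' hS' hne
      obtain ⟨v, -, rfl⟩ := Finset.mem_image.1 hS
      obtain ⟨v', -, rfl⟩ := Finset.mem_image.1 hS'
      rw [Finset.disjoint_left]
      intro x hx hx'
      rw [mem_compFinset] at hx hx'
      exact hne (compFinset_eq_of_reachable (hx.trans hx'.symm))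
    calc C.card * K ≤ ∑ S ∈ C, S.card := by
          rw [← smul_eq_mul]
          refine Finset.card_nsmul_le_sum _ _ _ fun S hS => ?_
          obtain ⟨v, hv, rfl⟩ := Finset.mem_image.1 hS
          exact (Finset.mem_filter.1 hv).2
      _ = (C.biUnion id).card := (Finset.card_biUnion hdisj).symm
      _ ≤ Fintype.card V := Finset.card_le_univ _
  calc _ ≤ C.powerset.card := by
        refine Finset.card_le_card_of_injOn (fun W => W.image (compFinset G)) ?_ ?_
        · intro W hW
          simp only [Finset.coe_filter, Finset.mem_univ, true_and, Set.mem_ofPred_eq] at hW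
          simp only [Finset.coe_powerset, Set.mem_preimage, Set.mem_powerset_iff,
            Finset.coe_subset]
          refine Finset.image_subset_image fun v hv => ?_
          simpa using hW.2 v hv
        · have key : ∀ W : Finset V, (∀ u w, G.Adj u w → (u ∈ W ↔ w ∈ W)) →
              (W.image (compFinset G)).biUnion id = W := by
            intro W hW
            ext x
            simp only [Finset.mem_biUnion, Finset.mem_image, id_eq, exists_exists_and_eq_and]
            constructor
            · rintro ⟨v, hv, hx⟩
              exact (mem_of_reachable hW (mem_compFinset.1 hx)).1 hv
            · intro hx
              exact ⟨x, hx, mem_compFinset.2 (SimpleGraph.Reachable.refl x)⟩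
          intro W hW W' hW' h
          simp only [Finset.coe_filter, Finset.mem_univ, true_and, Set.mem_ofPred_eq] at hW hW' h
          rw [← key W hW.1, ← key W' hW'.1, h]
    _ = 2 ^ C.card := Finset.card_powerset _
    _ ≤ _ := Nat.pow_le_pow_right (by norm_num) hCcard

lemma card_le_of_card_fiber_le {α β : Type*} [Fintype α] (φ : α → β) (E : α → Prop) {q : ℝ}
    (h : ∀ a, ((Finset.univ.filter fun b => φ b = φ a ∧ E b).card : ℝ) ≤
      q * (Finset.univ.filter fun b => φ b = φ a).card) :
    ((Finset.univ.filter E).card : ℝ) ≤ q * Fintype.card α := by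
  have h1 := Finset.card_eq_sum_card_fiberwise (s := Finset.univ.filter E)
    (t := Finset.univ.image φ) (f := φ) (fun a _ => by simp)
  have h2 := Finset.card_eq_sum_card_fiberwise (s := (Finset.univ : Finset α))
    (t := Finset.univ.image φ) (f := φ) (fun a _ => by simp)
  rw [← Finset.card_univ, h1, h2]
  push_cast
  rw [Finset.mul_sum]
  refine Finset.sum_le_sum fun y hy => ?_
  obtain ⟨a, -, rfl⟩ := Finset.mem_image.1 hy
  have h3 : (Finset.univ.filter E).filter (fun b => φ b = φ a) =
      Finset.univ.filter fun b => φ b = φ a ∧ E b := by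
    ext b
    simp [and_comm]
  rw [h3]
  exact h a

/-- The part of the choices that determines the first-stage graph. -/
def firstStage {m : ℕ} (R : Finset (Vtx (m + 1))) (ω : Dirs m) :
    Vtx (m + 1) → Fin (m + 1) × Option (Fin m) :=
  fun u => ((ω u).1, if u ∈ R then none else some (ω u).2)

lemma firstStage_eq_iff {m : ℕ} {R : Finset (Vtx (m + 1))} {ω ω' : Dirs m} :
    firstStage R ω = firstStage R ω' ↔
      ∀ u, (ω u).1 = (ω' u).1 ∧ (u ∉ R → ω u = ω' u) := by
  rw [funext_iff]
  refine forall_congr' fun u => ?_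
  by_cases h : u ∈ R
  · simp [firstStage, h]
  · simp only [firstStage, h, if_false, Prod.mk.injEq, Option.some.injEq, not_false_eq_true,
      true_imp_iff]
    exact ⟨fun h' => ⟨h'.1, Prod.ext h'.1 h'.2⟩, fun h' => ⟨h'.1, congrArg Prod.snd h'.2⟩⟩

lemma stageGraph_congr {m : ℕ} {R : Finset (Vtx (m + 1))} {ω ω' : Dirs m}
    (h : firstStage R ω = firstStage R ω') : stageGraph R ω = stageGraph R ω' := by
  rw [firstStage_eq_iff] at h
  unfold stageGraph
  congr 1
  ext u v
  rw [(h u).1]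
  by_cases hu : u ∈ R
  · simp [hu]
  · rw [(h u).2 hu]

lemma smallSet_congr {m K : ℕ} {R : Finset (Vtx (m + 1))} {ω ω' : Dirs m}
    (h : firstStage R ω = firstStage R ω') : smallSet R K ω = smallSet R K ω' := by
  unfold smallSet
  rw [stageGraph_congr h]

/-- The choices at `u` agreeing in the first stage with `ω₀`. -/
def fiberChoices {m : ℕ} (R : Finset (Vtx (m + 1))) (ω₀ : Dirs m) (u : Vtx (m + 1)) :
    Finset (Fin (m + 1) × Fin m) :=
  Finset.univ.filter fun q => q.1 = (ω₀ u).1 ∧ (u ∉ R → q = ω₀ u)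

lemma card_fiberChoices_of_mem {m : ℕ} {R : Finset (Vtx (m + 1))} (ω₀ : Dirs m)
    {u : Vtx (m + 1)} (hu : u ∈ R) : (fiberChoices R ω₀ u).card = m := by
  have : fiberChoices R ω₀ u = {(ω₀ u).1} ×ˢ (Finset.univ : Finset (Fin m)) := by
    ext ⟨i, j⟩
    simp [fiberChoices, hu, eq_comm]
  rw [this]
  simp

lemma card_fiberChoices_filter_le {m : ℕ} {R Z : Finset (Vtx (m + 1))} (ω₀ : Dirs m)
    {u : Vtx (m + 1)} (hu : u ∈ R) (hZ : flipAt (ω₀ u).1 u ∉ Z) :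
    (((fiberChoices R ω₀ u).filter fun q => flipAt (secondDir q) u ∉ Z).card : ℝ) ≤
      Real.exp (-(innerDeg Z Finset.univ u / m)) * (fiberChoices R ω₀ u).card := by
  set i₀ := (ω₀ u).1 with hi₀
  have h1 : innerDeg Z Finset.univ u ≤
      ((fiberChoices R ω₀ u).filter fun q => flipAt (secondDir q) u ∈ Z).card := by
    unfold innerDeg
    refine (Finset.card_le_card (t := ((fiberChoices R ω₀ u).filter
      fun q => flipAt (secondDir q) u ∈ Z).image secondDir) ?_).trans Finset.card_image_le
    intro i hi
    simp only [Finset.mem_filter, Finset.mem_univ, true_and] at hi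
    have hne : i ≠ i₀ := fun h => hZ (h ▸ hi)
    obtain ⟨j, hj⟩ := Fin.exists_succAbove_eq hne
    exact Finset.mem_image.2 ⟨(i₀, j), by
      simp [fiberChoices, hu, secondDir, hj, hi, ← hi₀], hj⟩
  have h2 := Finset.card_filter_add_card_filter_not (s := fiberChoices R ω₀ u)
    (p := fun q => flipAt (secondDir q) u ∈ Z)
  rw [card_fiberChoices_of_mem ω₀ hu] at h2 ⊢
  rcases Nat.eq_zero_or_pos m with rfl | hm
  · have : ((fiberChoices R ω₀ u).filter fun q => flipAt (secondDir q) u ∉ Z).card = 0 := by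
      omega
    rw [this]
    simp
  have hm' : (0 : ℝ) < m := by exact_mod_cast hm
  have h3 : (((fiberChoices R ω₀ u).filter fun q => flipAt (secondDir q) u ∉ Z).card : ℝ) +
      innerDeg Z Finset.univ u ≤ m := by
    exact_mod_cast (by omega :
      ((fiberChoices R ω₀ u).filter fun q => flipAt (secondDir q) u ∉ Z).card +
        innerDeg Z Finset.univ u ≤ m)
  calc _ ≤ (m : ℝ) - innerDeg Z Finset.univ u := by linarith
    _ = (-(innerDeg Z Finset.univ u / m : ℝ) + 1) * m := by field_simp; ring
    _ ≤ _ := by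
      gcongr
      exact Real.add_one_le_exp _

/-- There is a union `W` of components whose sprinkled edge boundary is large, yet no vertex of
`W` uses its second choice to leave `W`. -/
def SprinkleFails {m : ℕ} (R : Finset (Vtx (m + 1))) (K : ℕ) (M : ℝ) (ω : Dirs m) : Prop :=
  ∃ W : Finset (Vtx (m + 1)), (∀ u w, (stageGraph R ω).Adj u w → (u ∈ W ↔ w ∈ W)) ∧
    (∀ u ∈ W, flipAt (secondDir (ω u)) u ∈ W) ∧
    M ≤ ∑ u ∈ (W \ smallSet R K ω).filter (· ∈ R),
      (innerDeg (W ∪ smallSet R K ω)ᶜ Finset.univ u : ℝ)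

lemma mem_smallSet_iff_of_adj {m K : ℕ} {R : Finset (Vtx (m + 1))} {ω : Dirs m}
    {u w : Vtx (m + 1)} (h : (stageGraph R ω).Adj u w) :
    u ∈ smallSet R K ω ↔ w ∈ smallSet R K ω := by
  simp [smallSet, compFinset_eq_of_reachable h.reachable]

lemma card_fiber_noEscape_le {m : ℕ} {R W Z : Finset (Vtx (m + 1))} (ω₀ : Dirs m) {M : ℝ}
    (hm : 1 ≤ m) (hZ : ∀ u ∈ W, flipAt (ω₀ u).1 u ∉ Z)
    (hM : M ≤ ∑ u ∈ W.filter (· ∈ R), (innerDeg Z Finset.univ u : ℝ)) :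
    ((Finset.univ.filter fun ω : Dirs m => firstStage R ω = firstStage R ω₀ ∧
      ∀ u ∈ W.filter (· ∈ R), flipAt (secondDir (ω u)) u ∉ Z).card : ℝ) ≤
      Real.exp (-(M / m)) *
        (Finset.univ.filter fun ω : Dirs m => firstStage R ω = firstStage R ω₀).card := by
  have hm' : (0 : ℝ) < m := by exact_mod_cast hm
  have h1 : (Finset.univ.filter fun ω : Dirs m => firstStage R ω = firstStage R ω₀) =
      Fintype.piFinset (fiberChoices R ω₀) := by
    ext ω
    simp [firstStage_eq_iff, fiberChoices]
  have h2 : (Finset.univ.filter fun ω : Dirs m => firstStage R ω = firstStage R ω₀ ∧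
      ∀ u ∈ W.filter (· ∈ R), flipAt (secondDir (ω u)) u ∉ Z) =
      Fintype.piFinset fun u => if u ∈ W.filter (· ∈ R) then
        (fiberChoices R ω₀ u).filter (fun q => flipAt (secondDir q) u ∉ Z)
        else fiberChoices R ω₀ u := by
    ext ω
    simp only [Finset.mem_filter, Finset.mem_univ, true_and, firstStage_eq_iff,
      Fintype.mem_piFinset, ← forall_and]
    refine forall_congr' fun u => ?_
    by_cases hu : u ∈ W ∧ u ∈ R
    · simp [hu, fiberChoices]
    · simp [hu, fiberChoices]
  rw [h1, h2, Fintype.card_piFinset, Fintype.card_piFinset]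
  push_cast
  calc _ ≤ ∏ u, (if u ∈ W.filter (· ∈ R) then
          Real.exp (-(innerDeg Z Finset.univ u / m)) else 1) * ((fiberChoices R ω₀ u).card : ℝ) := by
        refine Finset.prod_le_prod (fun u _ => by positivity) fun u _ => ?_
        by_cases hu : u ∈ W.filter (· ∈ R)
        · rw [if_pos hu, if_pos hu]
          rw [Finset.mem_filter] at hu
          exact card_fiberChoices_filter_le ω₀ hu.2 (hZ u hu.1)
        · rw [if_neg hu, if_neg hu, one_mul]
    _ = Real.exp (-((∑ u ∈ W.filter (· ∈ R), (innerDeg Z Finset.univ u : ℝ)) / m)) *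
          ∏ u, ((fiberChoices R ω₀ u).card : ℝ) := by
        rw [Finset.prod_mul_distrib, Finset.prod_ite_mem, Finset.univ_inter, ← Real.exp_sum,
          Finset.sum_neg_distrib, Finset.sum_div]
    _ ≤ _ := by gcongr

lemma card_sprinkleFails_le {m K : ℕ} (hm : 1 ≤ m) (hK : 0 < K) (R : Finset (Vtx (m + 1)))
    (M : ℝ) :
    ((Finset.univ.filter (SprinkleFails (m := m) R K M)).card : ℝ) ≤
      2 ^ (2 ^ (m + 1) / K) * Real.exp (-(M / m)) * Fintype.card (Dirs m) := by
  refine card_le_of_card_fiber_le (firstStage R) _ fun ω₀ => ?_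
  suffices h : ((Finset.univ.filter fun ω => firstStage R ω = firstStage R ω₀ ∧
      SprinkleFails R K M ω).card : ℝ) ≤ 2 ^ (2 ^ (m + 1) / K) * Real.exp (-(M / m)) *
        (Finset.univ.filter fun ω : Dirs m => firstStage R ω = firstStage R ω₀).card by
    convert h
  set G := stageGraph R ω₀ with hG
  set L := smallSet R K ω₀ with hL
  set F := Finset.univ.filter fun W : Finset (Vtx (m + 1)) =>
    (∀ u w, G.Adj u w → (u ∈ W ↔ w ∈ W)) ∧ ∀ v ∈ W, K ≤ (compFinset G v).card with hF
  set F' := F.filter fun W =>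
    M ≤ ∑ u ∈ W.filter (· ∈ R), (innerDeg (W ∪ L)ᶜ Finset.univ u : ℝ) with hF'
  have hFcard : (F'.card : ℝ) ≤ 2 ^ (2 ^ (m + 1) / K) := by
    have h1 : F.card ≤ 2 ^ (Fintype.card (Vtx (m + 1)) / K) := by
      convert card_unions_of_large_comps_le G hK
    have h2 : Fintype.card (Vtx (m + 1)) = 2 ^ (m + 1) := by simp
    rw [h2] at h1
    have h3 : F'.card ≤ 2 ^ (2 ^ (m + 1) / K) :=
      (Finset.card_le_card (Finset.filter_subset _ _)).trans h1
    have h4 : (F'.card : ℝ) ≤ ((2 ^ (2 ^ (m + 1) / K) : ℕ) : ℝ) := Nat.cast_le.2 h3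
    rwa [Nat.cast_pow, Nat.cast_ofNat] at h4
  have hsub : (Finset.univ.filter fun ω => firstStage R ω = firstStage R ω₀ ∧
      SprinkleFails R K M ω) ⊆ F'.biUnion fun W => Finset.univ.filter fun ω : Dirs m =>
        firstStage R ω = firstStage R ω₀ ∧
          ∀ u ∈ W.filter (· ∈ R), flipAt (secondDir (ω u)) u ∉ (W ∪ L)ᶜ := by
    intro ω hω
    obtain ⟨hst, W, hW1, hW2, hW3⟩ := (Finset.mem_filter.1 hω).2
    rw [stageGraph_congr hst, ← hG] at hW1
    rw [smallSet_congr hst, ← hL] at hW3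
    refine Finset.mem_biUnion.2 ⟨W \ L, ?_, ?_⟩
    · simp only [hF', hF, Finset.mem_filter, Finset.mem_univ, true_and]
      refine ⟨⟨fun u w h => ?_, fun v hv => ?_⟩, ?_⟩
      · simp only [Finset.mem_sdiff]
        rw [hW1 u w h, mem_smallSet_iff_of_adj (K := K) h]
      · have := (Finset.mem_sdiff.1 hv).2
        simpa [hL, smallSet] using this
      · rwa [Finset.sdiff_union_self_eq_union]
    · simp only [Finset.mem_filter, Finset.mem_univ, true_and]
      refine ⟨hst, fun u hu => ?_⟩
      have := hW2 u (Finset.mem_sdiff.1 hu.1).1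
      simp [this]
  calc _ ≤ ((F'.biUnion fun W => Finset.univ.filter fun ω : Dirs m =>
        firstStage R ω = firstStage R ω₀ ∧
          ∀ u ∈ W.filter (· ∈ R), flipAt (secondDir (ω u)) u ∉ (W ∪ L)ᶜ).card : ℝ) := by
        exact_mod_cast Finset.card_le_card hsub
    _ ≤ ∑ W ∈ F', ((Finset.univ.filter fun ω : Dirs m =>
        firstStage R ω = firstStage R ω₀ ∧
          ∀ u ∈ W.filter (· ∈ R), flipAt (secondDir (ω u)) u ∉ (W ∪ L)ᶜ).card : ℝ) := by
        exact_mod_cast Finset.card_biUnion_le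
    _ ≤ ∑ W ∈ F', Real.exp (-(M / m)) *
        (Finset.univ.filter fun ω : Dirs m => firstStage R ω = firstStage R ω₀).card := by
        refine Finset.sum_le_sum fun W hW => ?_
        simp only [hF', hF, Finset.mem_filter, Finset.mem_univ, true_and] at hW
        refine card_fiber_noEscape_le ω₀ hm (fun u hu => ?_) hW.2
        have := (hW.1.1 u _ (stageGraph_adj_first R ω₀ u)).1 hu
        simp [this]
    _ = F'.card * (Real.exp (-(M / m)) *
        (Finset.univ.filter fun ω : Dirs m => firstStage R ω = firstStage R ω₀).card) := by
        rw [Finset.sum_const, nsmul_eq_mul]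
    _ ≤ _ := by
        rw [mul_assoc]
        gcongr

lemma exists_balanced_union_of_comps {V : Type*} [Fintype V] (G : SimpleGraph V) {ε : ℝ}
    (hε : ε ≤ 1 / 3) (h : ∀ v, ((compFinset G v).card : ℝ) < (1 - ε) * Fintype.card V) :
    ∃ W : Finset V, (∀ u w, G.Adj u w → (u ∈ W ↔ w ∈ W)) ∧
      ε * Fintype.card V ≤ W.card ∧ (W.card : ℝ) ≤ (1 - ε) * Fintype.card V := by
  set F := Finset.univ.filter fun W : Finset V => (∀ u w, G.Adj u w → (u ∈ W ↔ w ∈ W)) ∧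
    (W.card : ℝ) ≤ (1 - ε) * Fintype.card V with hF
  have hM : (0 : ℝ) ≤ Fintype.card V := by positivity
  have hne : F.Nonempty := ⟨∅, by
    simp only [hF, Finset.mem_filter, Finset.mem_univ, true_and]
    exact ⟨by simp, by simp only [Finset.card_empty, Nat.cast_zero]; nlinarith⟩⟩
  obtain ⟨W, hW, hmax⟩ := Finset.exists_max_image F Finset.card hne
  simp only [hF, Finset.mem_filter, Finset.mem_univ, true_and] at hW hmax
  refine ⟨W, hW.1, ?_, hW.2⟩
  by_contra! hlt
  have hcomp : ∀ v u w, G.Adj u w → (u ∈ compFinset G v ↔ w ∈ compFinset G v) := fun v u w huw =>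
    ⟨fun hu => mem_compFinset_of_adj hu huw, fun hw => mem_compFinset_of_adj hw huw.symm⟩
  obtain ⟨v, hv⟩ : ∃ v, v ∉ W := by
    by_contra! hall
    rw [Finset.eq_univ_iff_forall.2 hall, Finset.card_univ] at hlt
    nlinarith
  have hdisj : Disjoint W (compFinset G v) := by
    rw [Finset.disjoint_left]
    intro w hw hw'
    exact hv ((mem_of_reachable hW.1 (mem_compFinset.1 hw')).2 hw)
  have hcard := Finset.card_union_of_disjoint hdisj
  have hpos : 0 < (compFinset G v).card :=
    Finset.card_pos.2 ⟨v, mem_compFinset.2 (SimpleGraph.Reachable.refl v)⟩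
  by_cases hle : ((W ∪ compFinset G v).card : ℝ) ≤ (1 - ε) * Fintype.card V
  · have := hmax (W ∪ compFinset G v) ⟨fun u w huw => by
      rw [Finset.mem_union, Finset.mem_union, hW.1 u w huw, hcomp v u w huw], hle⟩
    omega
  · have h1 := hmax (compFinset G v) ⟨hcomp v, (h v).le⟩
    have h2 : ((compFinset G v).card : ℝ) ≤ W.card := by exact_mod_cast h1
    rw [hcard] at hle
    push_cast at hle
    nlinarith

lemma innerDeg_univ_le {n : ℕ} (S : Finset (Vtx n)) (u : Vtx n) :
    innerDeg S Finset.univ u ≤ n := by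
  have := Finset.card_filter_le (Finset.univ : Finset (Fin n)) fun i => flipAt i u ∈ S
  simpa [innerDeg] using this

lemma innerDeg_add_innerDeg_compl {n : ℕ} (S : Finset (Vtx n)) (u : Vtx n) :
    innerDeg S Finset.univ u + innerDeg Sᶜ Finset.univ u = n := by
  have := Finset.card_filter_add_card_filter_not (s := (Finset.univ : Finset (Fin n)))
    (p := fun i => flipAt i u ∈ S)
  simpa [innerDeg] using this

lemma innerDeg_mono {n : ℕ} {S S' : Finset (Vtx n)} (h : S ⊆ S') (u : Vtx n) :
    innerDeg S Finset.univ u ≤ innerDeg S' Finset.univ u :=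
  Finset.card_le_card (Finset.monotone_filter_right _ fun _ _ hi => h hi)

lemma innerDeg_union_le {n : ℕ} (S S' : Finset (Vtx n)) (u : Vtx n) :
    innerDeg (S ∪ S') Finset.univ u ≤ innerDeg S Finset.univ u + innerDeg S' Finset.univ u := by
  unfold innerDeg
  simp only [Finset.mem_union, Finset.filter_or]
  exact Finset.card_union_le _ _

lemma sum_univ_innerDeg {n : ℕ} (S : Finset (Vtx n)) :
    ∑ u, innerDeg S Finset.univ u = n * S.card := by
  simp only [innerDeg, Finset.card_filter]
  rw [Finset.sum_comm]
  have : ∀ i : Fin n, ∑ u : Vtx n, (if flipAt i u ∈ S then 1 else 0) = S.card := by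
    intro i
    have hb : Function.Bijective (flipAt i) :=
      Function.Involutive.bijective (flipAt_flipAt i)
    rw [hb.sum_comp (fun u => if u ∈ S then 1 else 0)]
    simp
  simp [this]

lemma logb_one_sub_le {ε : ℝ} (hε0 : 0 ≤ ε) (hε1 : ε < 1) : Real.logb 2 (1 - ε) ≤ -ε := by
  have h1 := Real.log_le_sub_one_of_pos (show 0 < 1 - ε by linarith)
  have h2 : Real.log 2 ≤ 1 := by linarith [Real.log_two_lt_d9]
  have h3 : 0 < Real.log 2 := Real.log_pos (by norm_num)
  rw [Real.logb, div_le_iff₀ h3]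
  nlinarith

lemma sum_outDeg_ge {n : ℕ} {W : Finset (Vtx n)} {ε : ℝ} (hε0 : 0 < ε) (hε1 : ε < 1)
    (hlow : ε * 2 ^ n ≤ W.card) (hupp : (W.card : ℝ) ≤ (1 - ε) * 2 ^ n) :
    ε ^ 2 * 2 ^ n ≤ ((∑ u ∈ W, innerDeg Wᶜ Finset.univ u : ℕ) : ℝ) := by
  have hW : (0 : ℝ) < W.card := lt_of_lt_of_le (by positivity) hlow
  have h1 : ∑ u ∈ W, innerDeg W Finset.univ u + ∑ u ∈ W, innerDeg Wᶜ Finset.univ u =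
      W.card * n := by
    rw [← Finset.sum_add_distrib, Finset.sum_congr rfl fun u _ => innerDeg_add_innerDeg_compl W u]
    simp
  have h2 : ((∑ u ∈ W, innerDeg W Finset.univ u : ℕ) : ℝ) +
      ((∑ u ∈ W, innerDeg Wᶜ Finset.univ u : ℕ) : ℝ) = W.card * n := by
    exact_mod_cast h1
  have h3 := sum_innerDeg_le Finset.univ W
  have h4 : Real.logb 2 W.card ≤ n - ε := by
    calc Real.logb 2 W.card ≤ Real.logb 2 ((1 - ε) * 2 ^ n) :=
          Real.logb_le_logb_of_le (by norm_num) hW hupp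
      _ = Real.logb 2 (1 - ε) + n := by
          rw [Real.logb_mul (by linarith) (by positivity), Real.logb_pow]
          simp
      _ ≤ _ := by linarith [logb_one_sub_le hε0.le hε1]
  nlinarith

/-- The pair of directions chosen at each vertex gives an outcome of the `2`-out model. -/
def toKOut {m : ℕ} (ω : Dirs m) : KOut (m + 1) 2 := fun v =>
  ⟨{flipAt (ω v).1 v, flipAt (secondDir (ω v)) v},
    Finset.card_pair fun h => secondDir_ne (ω v) (flipAt_left_injective v h).symm, by
      intro u hu
      rw [cubeGraph_adj_iff]
      simp only [Finset.mem_insert, Finset.mem_singleton] at hu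
      rcases hu with rfl | rfl
      · exact ⟨_, rfl⟩
      · exact ⟨_, rfl⟩⟩

lemma kOutGraph_adj_first {m : ℕ} (ω : Dirs m) (u : Vtx (m + 1)) :
    (kOutGraph (m + 1) 2 (toKOut ω)).Adj u (flipAt (ω u).1 u) :=
  (SimpleGraph.fromRel_adj _ _ _).2 ⟨(flipAt_ne_self _ _).symm, Or.inl (by simp [toKOut])⟩

lemma kOutGraph_adj_second {m : ℕ} (ω : Dirs m) (u : Vtx (m + 1)) :
    (kOutGraph (m + 1) 2 (toKOut ω)).Adj u (flipAt (secondDir (ω u)) u) :=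
  (SimpleGraph.fromRel_adj _ _ _).2 ⟨(flipAt_ne_self _ _).symm, Or.inl (by simp [toKOut])⟩

lemma stageGraph_le_kOutGraph {m : ℕ} (R : Finset (Vtx (m + 1))) (ω : Dirs m) :
    stageGraph R ω ≤ kOutGraph (m + 1) 2 (toKOut ω) := by
  intro u v h
  rcases (SimpleGraph.fromRel_adj _ _ _).1 h with ⟨-, (h | h) | (h | h)⟩
  · rw [h]; exact kOutGraph_adj_first ω u
  · rw [h.2]; exact kOutGraph_adj_second ω u
  · rw [h]; exact (kOutGraph_adj_first ω v).symm
  · rw [h.2]; exact (kOutGraph_adj_second ω v).symm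

lemma compSize_eq_card_compFinset {V : Type*} [Fintype V] (G : SimpleGraph V) (v : V) :
    compSize G v = (compFinset G v).card := by
  rw [compSize, Nat.card_eq_fintype_card, Fintype.card_subtype, compFinset]

/-- If there is no giant component, then either many vertices lie in small first-stage components
for some colour class, or the sprinkling fails for some colour class. -/
lemma small_or_sprinkleFails {m K : ℕ} (ω : Dirs m) {ε : ℝ} (hε0 : 0 < ε) (hε : ε ≤ 1 / 3)
    (h : ∀ v, (compSize (kOutGraph (m + 1) 2 (toKOut ω)) v : ℝ) < (1 - ε) * 2 ^ (m + 1)) :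
    ε ^ 2 * 2 ^ (m + 1) / (4 * (m + 1)) ≤
        ∑ c : ZMod (2 * (m + 1) + 1), ((smallSet (vtClass c) K ω).card : ℝ) ∨
      ∃ c : ZMod (2 * (m + 1) + 1),
        SprinkleFails (vtClass c) K (ε ^ 2 * 2 ^ (m + 1) / (2 * (2 * (m + 1) + 1))) ω := by
  rw [or_iff_not_imp_left]
  intro hsmall
  push Not at hsmall
  have hcardV : (Fintype.card (Vtx (m + 1)) : ℝ) = 2 ^ (m + 1) := by simp
  obtain ⟨W, hWG, hlow, hupp⟩ := exists_balanced_union_of_comps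
    (kOutGraph (m + 1) 2 (toKOut ω)) hε (fun v => by
      rw [hcardV, ← compSize_eq_card_compFinset]; exact h v)
  rw [hcardV] at hlow hupp
  set L := Finset.univ.biUnion fun c : ZMod (2 * (m + 1) + 1) => smallSet (vtClass c) K ω with hL
  have hLcard : (L.card : ℝ) ≤ ε ^ 2 * 2 ^ (m + 1) / (4 * (m + 1)) := by
    refine le_trans ?_ hsmall.le
    exact_mod_cast Finset.card_biUnion_le
  have hm0 : (0 : ℝ) < (m : ℝ) + 1 := by positivity
  rw [le_div_iff₀ (by positivity)] at hLcard
  have hD := sum_outDeg_ge hε0 (by linarith) hlow hupp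
  have h1 : ∑ u ∈ W, innerDeg Wᶜ Finset.univ u ≤
      ∑ u ∈ W \ L, innerDeg (W ∪ L)ᶜ Finset.univ u + 2 * ((m + 1) * L.card) := by
    have h2 : ∑ u ∈ W, innerDeg Wᶜ Finset.univ u =
        ∑ u ∈ W \ L, innerDeg Wᶜ Finset.univ u + ∑ u ∈ W ∩ L, innerDeg Wᶜ Finset.univ u := by
      rw [← Finset.sum_union (Finset.disjoint_sdiff_inter W L), Finset.sdiff_union_inter]
    have h3 : ∑ u ∈ W ∩ L, innerDeg Wᶜ Finset.univ u ≤ (m + 1) * L.card := by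
      calc _ ≤ ∑ u ∈ W ∩ L, (m + 1) := Finset.sum_le_sum fun u _ => innerDeg_univ_le _ u
        _ = (m + 1) * (W ∩ L).card := by simp [mul_comm]
        _ ≤ _ := Nat.mul_le_mul_left _ (Finset.card_le_card Finset.inter_subset_right)
    have h4 : ∑ u ∈ W \ L, innerDeg Wᶜ Finset.univ u ≤
        ∑ u ∈ W \ L, innerDeg (W ∪ L)ᶜ Finset.univ u + (m + 1) * L.card := by
      rw [← sum_univ_innerDeg]
      calc _ ≤ ∑ u ∈ W \ L, (innerDeg (W ∪ L)ᶜ Finset.univ u + innerDeg L Finset.univ u) := by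
            refine Finset.sum_le_sum fun u _ =>
              le_trans (innerDeg_mono ?_ u) (innerDeg_union_le _ _ u)
            intro x hx
            simp only [Finset.mem_compl, Finset.mem_union] at hx ⊢
            tauto
        _ ≤ _ := by
            rw [Finset.sum_add_distrib]
            exact Nat.add_le_add_left
              (Finset.sum_le_sum_of_subset (Finset.subset_univ _)) _
    omega
  have h1' : ((∑ u ∈ W, innerDeg Wᶜ Finset.univ u : ℕ) : ℝ) ≤
      ∑ u ∈ W \ L, (innerDeg (W ∪ L)ᶜ Finset.univ u : ℝ) + 2 * (((m : ℝ) + 1) * L.card) := by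
    exact_mod_cast h1
  have h5 : ε ^ 2 * 2 ^ (m + 1) / 2 ≤ ∑ u ∈ W \ L, (innerDeg (W ∪ L)ᶜ Finset.univ u : ℝ) := by
    linarith
  obtain ⟨c, hc⟩ : ∃ c : ZMod (2 * (m + 1) + 1),
      ε ^ 2 * 2 ^ (m + 1) / (2 * (2 * (m + 1) + 1)) ≤
        ∑ u ∈ (W \ L).filter (· ∈ vtClass c), (innerDeg (W ∪ L)ᶜ Finset.univ u : ℝ) := by
    by_contra! hlt
    have h6 := Finset.sum_lt_sum_of_nonempty (s := (Finset.univ : Finset (ZMod (2 * (m + 1) + 1))))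
      Finset.univ_nonempty fun c _ => hlt c
    have h7 : ∑ c : ZMod (2 * (m + 1) + 1), ∑ u ∈ (W \ L).filter (· ∈ vtClass c),
        (innerDeg (W ∪ L)ᶜ Finset.univ u : ℝ) =
        ∑ u ∈ W \ L, (innerDeg (W ∪ L)ᶜ Finset.univ u : ℝ) := by
      rw [← Finset.sum_fiberwise (W \ L) vtColour]
      refine Finset.sum_congr rfl fun c _ => Finset.sum_congr ?_ fun _ _ => rfl
      ext u
      simp [vtClass]
    rw [h7, Finset.sum_const, Finset.card_univ, ZMod.card, nsmul_eq_mul] at h6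
    push_cast at h6
    have h8 : (2 * ((m : ℝ) + 1) + 1) * (ε ^ 2 * 2 ^ (m + 1) / (2 * (2 * (m + 1) + 1))) =
        ε ^ 2 * 2 ^ (m + 1) / 2 := by field_simp
    linarith
  have hLc : smallSet (vtClass c) K ω ⊆ L :=
    Finset.subset_biUnion_of_mem (fun c => smallSet (vtClass c) K ω) (Finset.mem_univ c)
  refine ⟨c, W, fun u w huw => hWG u w (stageGraph_le_kOutGraph _ ω huw), fun u hu =>
    (hWG u _ (kOutGraph_adj_second ω u)).1 hu, hc.trans ?_⟩
  calc _ ≤ ∑ u ∈ (W \ L).filter (· ∈ vtClass c),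
        (innerDeg (W ∪ smallSet (vtClass c) K ω)ᶜ Finset.univ u : ℝ) := by
        refine Finset.sum_le_sum fun u _ => ?_
        exact_mod_cast innerDeg_mono
          (Finset.compl_subset_compl.2 (Finset.union_subset_union_right hLc)) u
    _ ≤ _ := by
        refine Finset.sum_le_sum_of_subset_of_nonneg ?_ fun u _ _ => by positivity
        exact Finset.filter_subset_filter _ (Finset.sdiff_subset_sdiff le_rfl hLc)

lemma card_filter_pair_eq {m : ℕ} (v : Vtx (m + 1)) {s : Finset (Vtx (m + 1))} (hs : s.card = 2)
    (hadj : ∀ u ∈ s, (cubeGraph (m + 1)).Adj v u) :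
    (Finset.univ.filter fun q : Fin (m + 1) × Fin m =>
      ({flipAt q.1 v, flipAt (secondDir q) v} : Finset (Vtx (m + 1))) = s).card = 2 := by
  obtain ⟨x, y, hxy, rfl⟩ := Finset.card_eq_two.1 hs
  obtain ⟨a, rfl⟩ := (cubeGraph_adj_iff v x).1 (hadj x (by simp))
  obtain ⟨b, rfl⟩ := (cubeGraph_adj_iff v y).1 (hadj y (by simp))
  have hab : a ≠ b := fun h => hxy (by rw [h])
  obtain ⟨jb, hjb⟩ := Fin.exists_succAbove_eq hab.symm
  obtain ⟨ja, hja⟩ := Fin.exists_succAbove_eq hab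
  have hinj := flipAt_left_injective v
  have hset : (Finset.univ.filter fun q : Fin (m + 1) × Fin m =>
      ({flipAt q.1 v, flipAt (secondDir q) v} : Finset (Vtx (m + 1))) =
        {flipAt a v, flipAt b v}) = {(a, jb), (b, ja)} := by
    ext ⟨i, j⟩
    simp only [Finset.mem_filter, Finset.mem_univ, true_and, Finset.mem_insert,
      Finset.mem_singleton, Prod.mk.injEq]
    rw [← Finset.coe_inj]
    simp only [Finset.coe_insert, Finset.coe_singleton, Set.pair_eq_pair_iff, hinj.eq_iff,
      secondDir]
    refine or_congr ?_ ?_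
    · refine and_congr_right fun hi => ?_
      rw [hi, ← hjb, Fin.succAbove_right_inj]
    · refine and_congr_right fun hi => ?_
      rw [hi, ← hja, Fin.succAbove_right_inj]
  rw [hset]
  exact Finset.card_pair fun h => hab (congrArg Prod.fst h)

lemma card_filter_toKOut_eq {m : ℕ} (κ : KOut (m + 1) 2) :
    (Finset.univ.filter fun ω : Dirs m => toKOut ω = κ).card = 2 ^ Fintype.card (Vtx (m + 1)) := by
  have h : (Finset.univ.filter fun ω : Dirs m => toKOut ω = κ) =
      Fintype.piFinset fun v => Finset.univ.filter fun q : Fin (m + 1) × Fin m =>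
        ({flipAt q.1 v, flipAt (secondDir q) v} : Finset (Vtx (m + 1))) = (κ v).1 := by
    ext ω
    simp only [Finset.mem_filter, Finset.mem_univ, true_and, Fintype.mem_piFinset, funext_iff,
      Subtype.ext_iff, toKOut]
  rw [h, Fintype.card_piFinset, Finset.prod_congr rfl fun v _ =>
    card_filter_pair_eq v (κ v).2.1 (κ v).2.2]
  simp

lemma prob_eq_dirs {m : ℕ} (p : KOut (m + 1) 2 → Prop) :
    prob p = ((Finset.univ.filter fun ω : Dirs m => p (toKOut ω)).card : ℝ) /
      Fintype.card (Dirs m) := by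
  have key : ∀ p : KOut (m + 1) 2 → Prop, (Finset.univ.filter fun ω : Dirs m => p (toKOut ω)).card =
      (Finset.univ.filter p).card * 2 ^ Fintype.card (Vtx (m + 1)) := by
    intro p
    rw [Finset.card_eq_sum_card_fiberwise (f := toKOut) (t := Finset.univ.filter p)
      (fun ω hω => by simpa using hω), Finset.sum_congr rfl fun κ hκ => ?_, Finset.sum_const,
      smul_eq_mul]
    rw [← card_filter_toKOut_eq κ, Finset.filter_filter]
    congr 1
    refine Finset.filter_congr fun ω _ => ⟨fun h => h.2, fun h => ⟨?_, h⟩⟩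
    rw [h]
    exact (Finset.mem_filter.1 hκ).2
  have htot := key fun _ => True
  simp only [Finset.filter_true, Finset.card_univ] at htot
  rw [htot, key p, prob, Nat.card_eq_fintype_card, Nat.card_eq_fintype_card,
    Fintype.card_subtype]
  push_cast
  rw [mul_div_mul_right _ _ (by positivity)]

lemma prob_le_one {Ω : Type*} [Finite Ω] (p : Ω → Prop) : prob p ≤ 1 :=
  div_le_one_of_le₀ (by exact_mod_cast Nat.card_le_card_of_injective _ Subtype.val_injective)
    (by positivity)

lemma card_filter_mul_le_sum {α : Type*} [Fintype α] (f : α → ℝ) (hf : ∀ a, 0 ≤ f a) (t : ℝ) :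
    ((Finset.univ.filter fun a => t ≤ f a).card : ℝ) * t ≤ ∑ a, f a := by
  rw [← nsmul_eq_mul]
  exact (Finset.card_nsmul_le_sum _ f t fun a ha => (Finset.mem_filter.1 ha).2).trans
    (Finset.sum_le_sum_of_subset_of_nonneg (Finset.subset_univ _) fun a _ _ => hf a)

lemma card_filter_sum_smallSet_le {m K : ℕ} (hm : 1 ≤ m) {l ε : ℝ} (hε : 0 < ε) (hl : 1 ≤ l)
    (hK : Real.logb 2 K ≤ l) (hx : 2 * Real.exp 1 ^ 3 * l ^ 2 / √((m : ℝ) + 1) ≤ 1) :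
    ((Finset.univ.filter fun ω : Dirs m => ε ^ 2 * 2 ^ (m + 1) / (4 * ((m : ℝ) + 1)) ≤
      ∑ c : ZMod (2 * (m + 1) + 1), ((smallSet (vtClass c) K ω).card : ℝ)).card : ℝ) ≤
      12 / ε ^ 2 * (((m : ℝ) + 1) * (2 * Real.exp 1 ^ 3 * l ^ 2 / √((m : ℝ) + 1)) ^ 3) *
        Fintype.card (Dirs m) := by
  set x := 2 * Real.exp 1 ^ 3 * l ^ 2 / √((m : ℝ) + 1) with hxdef
  set t := ε ^ 2 * 2 ^ (m + 1) / (4 * ((m : ℝ) + 1)) with ht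
  set D := (Fintype.card (Dirs m) : ℝ) with hD
  have ht0 : 0 < t := by positivity
  have hx0 : 0 ≤ x := by positivity
  have hclass : ∀ c : ZMod (2 * (m + 1) + 1),
      ∑ ω : Dirs m, ((smallSet (vtClass c) K ω).card : ℝ) ≤
        2 ^ (m + 1) * (x ^ 3 / ((m : ℝ) + 1) * D) := by
    intro c
    have hswap : ∑ ω : Dirs m, ((smallSet (vtClass c) K ω).card : ℝ) =
        ∑ v, ((Finset.univ.filter fun ω : Dirs m => v ∈ smallSet (vtClass c) K ω).card : ℝ) := by
      have := Finset.sum_card_bipartiteAbove_eq_sum_card_bipartiteBelow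
        (s := (Finset.univ : Finset (Dirs m))) (t := (Finset.univ : Finset (Vtx (m + 1))))
        fun ω v => v ∈ smallSet (vtClass c) K ω
      simp only [Finset.bipartiteAbove, Finset.bipartiteBelow, Finset.filter_univ_mem] at this
      exact_mod_cast this
    rw [hswap]
    refine (Finset.sum_le_card_nsmul _ _ _ fun v _ =>
      card_mem_smallSet_le hm (isCode_vtClass c) hl hK hx v).trans_eq ?_
    simp [nsmul_eq_mul, hxdef, hD]
  set B := Finset.univ.filter fun ω : Dirs m =>
    t ≤ ∑ c : ZMod (2 * (m + 1) + 1), ((smallSet (vtClass c) K ω).card : ℝ) with hB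
  have hmarkov : (B.card : ℝ) * t ≤
      (2 * ((m : ℝ) + 1) + 1) * (2 ^ (m + 1) * (x ^ 3 / ((m : ℝ) + 1) * D)) := by
    calc (B.card : ℝ) * t
        ≤ ∑ ω : Dirs m, ∑ c : ZMod (2 * (m + 1) + 1), ((smallSet (vtClass c) K ω).card : ℝ) :=
        card_filter_mul_le_sum _ (fun ω => Finset.sum_nonneg fun c _ => Nat.cast_nonneg _) t
      _ = ∑ c : ZMod (2 * (m + 1) + 1), ∑ ω : Dirs m, ((smallSet (vtClass c) K ω).card : ℝ) :=
        Finset.sum_comm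
      _ ≤ _ := by
        refine (Finset.sum_le_card_nsmul _ _ _ fun c _ => hclass c).trans_eq ?_
        rw [Finset.card_univ, ZMod.card, nsmul_eq_mul]
        push_cast
        ring
  rw [← le_div_iff₀ ht0] at hmarkov
  refine hmarkov.trans ?_
  have hD0 : 0 ≤ D := by positivity
  rw [div_le_iff₀ ht0, ht]
  have h1 : 12 / ε ^ 2 * (((m : ℝ) + 1) * x ^ 3) * D * (ε ^ 2 * 2 ^ (m + 1) / (4 * ((m : ℝ) + 1)))
      = (3 * ((m : ℝ) + 1)) * (2 ^ (m + 1) * (x ^ 3 / ((m : ℝ) + 1) * D)) := by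
    field_simp
    ring
  rw [h1]
  refine mul_le_mul_of_nonneg_right ?_ (by positivity)
  have : (0 : ℝ) ≤ m := by positivity
  have : (1 : ℝ) ≤ m := by exact_mod_cast hm
  linarith

lemma one_sub_le_prob_giant {m K : ℕ} (hm : 1 ≤ m) (hK0 : 0 < K) {l ε : ℝ} (hε : 0 < ε)
    (hε3 : ε ≤ 1 / 3) (hl : 1 ≤ l) (hK : Real.logb 2 K ≤ l)
    (hx : 2 * Real.exp 1 ^ 3 * l ^ 2 / √((m : ℝ) + 1) ≤ 1) :
    1 - (12 / ε ^ 2 * (((m : ℝ) + 1) * (2 * Real.exp 1 ^ 3 * l ^ 2 / √((m : ℝ) + 1)) ^ 3) +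
      (2 * ((m : ℝ) + 1) + 1) * (2 ^ (2 ^ (m + 1) / K) *
        Real.exp (-(ε ^ 2 * 2 ^ (m + 1) / (2 * (2 * ((m : ℝ) + 1) + 1)) / m)))) ≤
      prob (fun ω : KOut (m + 1) 2 => ∃ v : Vtx (m + 1),
        (1 - ε) * 2 ^ (m + 1) ≤ (compSize (kOutGraph (m + 1) 2 ω) v : ℝ)) := by
  have : Nonempty (Fin m) := ⟨⟨0, hm⟩⟩
  have hDpos : (0 : ℝ) < Fintype.card (Dirs m) := by exact_mod_cast Fintype.card_pos
  rw [prob_eq_dirs, le_div_iff₀ hDpos]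
  set good : Dirs m → Prop := fun ω => ∃ v : Vtx (m + 1),
    (1 - ε) * 2 ^ (m + 1) ≤ (compSize (kOutGraph (m + 1) 2 (toKOut ω)) v : ℝ) with hgood
  set M := ε ^ 2 * 2 ^ (m + 1) / (2 * (2 * ((m : ℝ) + 1) + 1)) with hM
  set A := Finset.univ.filter fun ω : Dirs m => ε ^ 2 * 2 ^ (m + 1) / (4 * ((m : ℝ) + 1)) ≤
    ∑ c : ZMod (2 * (m + 1) + 1), ((smallSet (vtClass c) K ω).card : ℝ) with hA
  set S := (Finset.univ : Finset (ZMod (2 * (m + 1) + 1))).biUnion fun c =>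
    Finset.univ.filter (SprinkleFails (m := m) (vtClass c) K M) with hS
  have hsub : Finset.univ.filter (fun ω => ¬ good ω) ⊆ A ∪ S := by
    intro ω hω
    have hω' := (Finset.mem_filter.1 hω).2
    simp only [hgood, not_exists, not_le] at hω'
    rcases small_or_sprinkleFails (K := K) ω hε hε3 hω' with h | ⟨c, hc⟩
    · exact Finset.mem_union_left _ (Finset.mem_filter.2 ⟨Finset.mem_univ _, h⟩)
    · exact Finset.mem_union_right _ (Finset.mem_biUnion.2
        ⟨c, Finset.mem_univ _, Finset.mem_filter.2 ⟨Finset.mem_univ _, hc⟩⟩)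
  have hS' : (S.card : ℝ) ≤ (2 * ((m : ℝ) + 1) + 1) * (2 ^ (2 ^ (m + 1) / K) *
      Real.exp (-(M / m)) * Fintype.card (Dirs m)) := by
    have h1 : (S.card : ℝ) ≤ ∑ c : ZMod (2 * (m + 1) + 1),
        ((Finset.univ.filter (SprinkleFails (m := m) (vtClass c) K M)).card : ℝ) := by
      exact_mod_cast Finset.card_biUnion_le
    refine h1.trans ((Finset.sum_le_card_nsmul _ _ _ fun c _ =>
      card_sprinkleFails_le hm hK0 (vtClass c) M).trans_eq ?_)
    rw [Finset.card_univ, ZMod.card, nsmul_eq_mul]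
    push_cast
    ring
  refine le_of_le_of_eq (b := ((Finset.univ.filter good).card : ℝ)) ?_ (by congr!)
  have hA' : (A.card : ℝ) ≤ _ := card_filter_sum_smallSet_le hm hε hl hK hx
  have hbad : ((Finset.univ.filter fun ω => ¬ good ω).card : ℝ) ≤ A.card + S.card := by
    exact_mod_cast (Finset.card_le_card hsub).trans (Finset.card_union_le _ _)
  have hsum : ((Finset.univ.filter good).card : ℝ) +
      (Finset.univ.filter fun ω => ¬ good ω).card = Fintype.card (Dirs m) := by
    exact_mod_cast Finset.card_filter_add_card_filter_not (s := Finset.univ) good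
  linarith

lemma tendsto_log_sqrt_pow_div_sqrt (k : ℕ) :
    Tendsto (fun n : ℕ => Real.log √(n : ℝ) ^ k / √(n : ℝ)) atTop (nhds 0) := by
  have h := Real.tendsto_pow_log_div_mul_add_atTop 1 0 k one_ne_zero
  simp only [one_mul, add_zero] at h
  exact (h.comp Real.tendsto_sqrt_atTop).comp tendsto_natCast_atTop_atTop

lemma logb_eq_log_sqrt {n : ℕ} :
    3 * Real.logb 2 n = 6 / Real.log 2 * Real.log √(n : ℝ) := by
  rw [Real.log_sqrt (Nat.cast_nonneg n), Real.logb]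
  ring

lemma tendsto_smallWeight :
    Tendsto (fun n : ℕ => 2 * Real.exp 1 ^ 3 * (3 * Real.logb 2 n) ^ 2 / √(n : ℝ))
      atTop (nhds 0) := by
  have h := (tendsto_log_sqrt_pow_div_sqrt 2).const_mul
    (2 * Real.exp 1 ^ 3 * (6 / Real.log 2) ^ 2)
  rw [mul_zero] at h
  refine h.congr fun n => ?_
  rw [logb_eq_log_sqrt]
  ring

lemma tendsto_mul_smallWeight_pow :
    Tendsto (fun n : ℕ => (n : ℝ) *
      (2 * Real.exp 1 ^ 3 * (3 * Real.logb 2 n) ^ 2 / √(n : ℝ)) ^ 3) atTop (nhds 0) := by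
  have h := (tendsto_log_sqrt_pow_div_sqrt 6).const_mul
    (8 * Real.exp 1 ^ 9 * (6 / Real.log 2) ^ 6)
  rw [mul_zero] at h
  refine h.congr' ?_
  filter_upwards [eventually_gt_atTop 0] with n hn
  have hpos : 0 < √(n : ℝ) := Real.sqrt_pos.2 (by exact_mod_cast hn)
  have hsq : (n : ℝ) = √(n : ℝ) ^ 2 := (Real.sq_sqrt (Nat.cast_nonneg n)).symm
  rw [logb_eq_log_sqrt]
  generalize √(n : ℝ) = y at *
  rw [hsq]
  field_simp
  ring

lemma sprinkle_bound {m : ℕ} (hm : 1 ≤ m) {ε : ℝ} (hε : 0 < ε)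
    (hlarge : 12 / ε ^ 2 ≤ (m : ℝ) + 1) :
    (2 * ((m : ℝ) + 1) + 1) * (2 ^ (2 ^ (m + 1) / (m + 1) ^ 3) *
        Real.exp (-(ε ^ 2 * 2 ^ (m + 1) / (2 * (2 * ((m : ℝ) + 1) + 1)) / m))) ≤
      36 / ε ^ 2 * (((m : ℝ) + 1) ^ 3 / 2 ^ (m + 1)) := by
  have hm' : (1 : ℝ) ≤ m := by exact_mod_cast hm
  set T : ℝ := 2 ^ (m + 1) with hT
  have hT0 : 0 < T := by positivity
  set N : ℝ := (m : ℝ) + 1 with hN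
  have hN0 : 0 < N := by positivity
  have hpow : (2 : ℝ) ^ (2 ^ (m + 1) / (m + 1) ^ 3) ≤ Real.exp (T / N ^ 3) := by
    calc (2 : ℝ) ^ (2 ^ (m + 1) / (m + 1) ^ 3)
        ≤ Real.exp 1 ^ (2 ^ (m + 1) / (m + 1) ^ 3) := by
          gcongr
          linarith [Real.add_one_le_exp (1 : ℝ)]
      _ = Real.exp ((2 ^ (m + 1) / (m + 1) ^ 3 : ℕ) : ℝ) := by
          rw [← Real.exp_nat_mul, mul_one]
      _ ≤ _ := by
          refine Real.exp_le_exp.2 (Nat.cast_div_le.trans_eq ?_)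
          push_cast
          rfl
  set z := ε ^ 2 * T / (12 * N ^ 2) with hz
  have hz0 : 0 < z := by positivity
  have h1 : T / N ^ 3 ≤ z := by
    rw [div_le_iff₀ (by positivity)] at hlarge
    rw [hz, div_le_div_iff₀ (by positivity) (by positivity)]
    have : 0 ≤ T * N ^ 2 := by positivity
    nlinarith
  have h2 : 2 * z ≤ ε ^ 2 * T / (2 * (2 * N + 1)) / m := by
    rw [hz, div_div, ← mul_div_assoc, div_le_div_iff₀ (by positivity) (by positivity)]
    have h3 : 2 * (2 * N + 1) * m ≤ 6 * N ^ 2 := by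
      rw [hN]; nlinarith
    have : 0 ≤ ε ^ 2 * T := by positivity
    nlinarith
  have hexp : Real.exp (-z) ≤ z⁻¹ := by
    rw [Real.exp_neg]
    gcongr
    linarith [Real.add_one_le_exp z]
  calc (2 * N + 1) * (2 ^ (2 ^ (m + 1) / (m + 1) ^ 3) *
        Real.exp (-(ε ^ 2 * T / (2 * (2 * N + 1)) / m)))
      ≤ (3 * N) * (Real.exp (T / N ^ 3) *
        Real.exp (-(ε ^ 2 * T / (2 * (2 * N + 1)) / m))) := by
        gcongr
        linarith
    _ = (3 * N) * Real.exp (T / N ^ 3 + -(ε ^ 2 * T / (2 * (2 * N + 1)) / m)) := by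
        rw [Real.exp_add]
    _ ≤ (3 * N) * Real.exp (-z) := by
        gcongr
        linarith
    _ ≤ (3 * N) * z⁻¹ := by gcongr
    _ = _ := by
        rw [hz]
        field_simp
        ring

lemma tendsto_prob_giant {ε : ℝ} (hε : 0 < ε) (hε3 : ε ≤ 1 / 3) :
    Tendsto (fun m : ℕ => prob (fun ω : KOut (m + 1) 2 => ∃ v : Vtx (m + 1),
      (1 - ε) * 2 ^ (m + 1) ≤ (compSize (kOutGraph (m + 1) 2 ω) v : ℝ))) atTop (nhds 1) := by
  have hsmall := (tendsto_add_atTop_iff_nat 1).2 tendsto_mul_smallWeight_pow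
  have hweight := (tendsto_add_atTop_iff_nat 1).2 tendsto_smallWeight
  have hspr := (tendsto_add_atTop_iff_nat 1).2
    (tendsto_pow_const_div_const_pow_of_one_lt 3 (one_lt_two (α := ℝ)))
  have hlow := ((hsmall.const_mul (12 / ε ^ 2)).add (hspr.const_mul (36 / ε ^ 2))).const_sub 1
  simp only [mul_zero, add_zero, sub_zero] at hlow
  refine tendsto_of_tendsto_of_tendsto_of_le_of_le' hlow tendsto_const_nhds ?_
    (Eventually.of_forall fun m => prob_le_one _)
  have hlarge := (tendsto_natCast_atTop_atTop (R := ℝ)).eventually_ge_atTop (12 / ε ^ 2)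
  filter_upwards [hweight.eventually_le_const one_pos, eventually_ge_atTop 1, hlarge]
    with m hx hm hm'
  push_cast at hx ⊢
  have hm1 : (1 : ℝ) ≤ m := by exact_mod_cast hm
  have hl : 1 ≤ 3 * Real.logb 2 ((m : ℝ) + 1) := by
    have : 1 ≤ Real.logb 2 ((m : ℝ) + 1) := by
      rw [Real.le_logb_iff_rpow_le one_lt_two (by positivity), Real.rpow_one]
      linarith
    linarith
  have hK : Real.logb 2 (((m + 1) ^ 3 : ℕ) : ℝ) ≤ 3 * Real.logb 2 ((m : ℝ) + 1) := by
    push_cast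
    rw [Real.logb_pow]
    norm_num
  refine le_trans ?_ (one_sub_le_prob_giant hm (Nat.pow_pos m.succ_pos) hε hε3 hl hK hx)
  have := sprinkle_bound hm hε (by linarith : 12 / ε ^ 2 ≤ (m : ℝ) + 1)
  gcongr

lemma prob_mono {Ω : Type*} [Finite Ω] {p q : Ω → Prop} (h : ∀ ω, p ω → q ω) :
    prob p ≤ prob q := by
  unfold prob
  gcongr
  exact Nat.card_le_card_of_injective _ (Subtype.impEmbedding p q h).injective

/-- For every `ε > 0`, the probability that `Q^n(2)` contains a connected component
with at least `(1−ε)·2^n` vertices tends to `1` as `n → ∞`. -/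
theorem stmt_2 (ε : ℝ) (hε : 0 < ε) :
    Tendsto (fun n : ℕ =>
        prob (fun ω : KOut n 2 =>
          ∃ v : Vtx n, (1 - ε) * 2 ^ n ≤ (compSize (kOutGraph n 2 ω) v : ℝ)))
      atTop (nhds 1) := by
  rw [← tendsto_add_atTop_iff_nat 1]
  refine tendsto_of_tendsto_of_tendsto_of_le_of_le
    (tendsto_prob_giant (lt_min hε (by norm_num : (0 : ℝ) < 1 / 3)) (min_le_right _ _))
    tendsto_const_nhds (fun m => prob_mono ?_) fun m => prob_le_one _
  rintro ω ⟨v, hv⟩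
  refine ⟨v, le_trans ?_ hv⟩
  gcongr
  exact min_le_left _ _
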